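/- Let K be a neighbourly normal 3-pseudomanifold with exactly 8 vertices. If K is not a combinatorial 3-manifold and no vertex of K has its link isomorphic to the 7-vertex torus T, then K is isomorphic to one of N_5, N_6, N_7, N_8, …, N_15. -/

import Mathlib

/-! Basic framework for finite simplicial complexes, pseudomanifolds and
bistellar moves, following Datta–Nilakantan. A complex is recorded as the
finite set of its faces (nonempty finite subsets of the vertex type). -/

namespace NPM

variable {α β : Type*} [DecidableEq α] [DecidableEq β]

/-- A "complex" datum: a finite family of finite subsets of `α`. -/
abbrev Complex (α : Type*) := Finset (Finset α)

/-- `K` is a simplicial complex: a nonempty collection of nonempty sets,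
closed under passing to nonempty subsets. -/
def IsComplex (K : Complex α) : Prop :=
  K.Nonempty ∧ (∀ σ ∈ K, σ.Nonempty) ∧ ∀ σ ∈ K, ∀ τ ⊆ σ, τ.Nonempty → τ ∈ K

/-- The vertex set of `K`. -/
def verts (K : Complex α) : Finset α := K.sup id

/-- `K` is pure of dimension `d`: every face is contained in a face with
`d+1` vertices. -/
def IsPure (K : Complex α) (d : ℕ) : Prop :=
  ∀ σ ∈ K, ∃ τ ∈ K, σ ⊆ τ ∧ τ.card = d + 1

/-- The facets ("`d`-faces") of a pure `d`-dimensional complex. -/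
def facets (K : Complex α) (d : ℕ) : Complex α := K.filter (fun σ => σ.card = d + 1)

/-- The link of a face `σ` in `K`. -/
def link (K : Complex α) (σ : Finset α) : Complex α :=
  K.filter (fun τ => Disjoint τ σ ∧ σ ∪ τ ∈ K)

/-- The degree of a face: the number of vertices of its link. -/
def degree (K : Complex α) (σ : Finset α) : ℕ := (verts (link K σ)).card

/-- A weak `d`-pseudomanifold: a pure `d`-dimensional complex in which every
`(d-1)`-face (i.e. face with `d` vertices) lies in exactly two facets. -/
def WeakPM (K : Complex α) (d : ℕ) : Prop :=
  IsComplex K ∧ IsPure K d ∧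
    ∀ σ ∈ K, σ.card = d → (K.filter fun τ => σ ⊆ τ ∧ τ.card = d + 1).card = 2

/-- Strong connectedness: any two facets are joined by a chain of facets in
which consecutive facets meet in a `(d-1)`-face. -/
def SConn (K : Complex α) (d : ℕ) : Prop :=
  ∀ σ ∈ facets K d, ∀ τ ∈ facets K d,
    Relation.ReflTransGen
      (fun a b => a ∈ facets K d ∧ b ∈ facets K d ∧ (a ∩ b).card = d) σ τ

/-- A `d`-pseudomanifold: a strongly connected weak `d`-pseudomanifold. -/
def IsPM (K : Complex α) (d : ℕ) : Prop := WeakPM K d ∧ SConn K d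

/-- Connectedness of a complex: the graph of vertices and edges is connected. -/
def Conn (K : Complex α) : Prop :=
  (verts K).Nonempty ∧ ∀ u ∈ verts K, ∀ v ∈ verts K,
    Relation.ReflTransGen (fun a b => a ≠ b ∧ ({a, b} : Finset α) ∈ K) u v

/-- A normal `d`-pseudomanifold: a connected weak `d`-pseudomanifold in which
the link of every face of dimension `≤ d - 2` is connected. -/
def NormalPM (K : Complex α) (d : ℕ) : Prop :=
  WeakPM K d ∧ Conn K ∧ ∀ σ ∈ K, σ.card + 1 ≤ d → Conn (link K σ)

/-- `K` is neighbourly: every pair of vertices forms an edge. -/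
def Neighbourly (K : Complex α) : Prop :=
  ∀ u ∈ verts K, ∀ v ∈ verts K, u ≠ v → ({u, v} : Finset α) ∈ K

/-- Isomorphism of complexes: a map injective on the vertex set carrying the
faces of `K` exactly onto the faces of `L`. -/
def Iso (K : Complex α) (L : Complex β) : Prop :=
  ∃ f : α → β, Set.InjOn f ↑(verts K) ∧ L = K.image (fun σ => σ.image f)

/-- The complex generated by a family of facets: all nonempty subsets. -/
def genCx (F : Finset (Finset α)) : Complex α :=
  F.biUnion fun σ => σ.powerset.filter (fun τ => τ.Nonempty)

/-- The standard sphere on the vertex set `B`: all nonempty proper subsets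
of `B`. -/
def stdSphere (B : Finset α) : Complex α :=
  B.powerset.filter fun τ => τ.Nonempty ∧ τ ≠ B

/-- In a weak `d`-pseudomanifold, a removable `(d-i)`-face `A`: its link is a
standard sphere `S^{i-1}_{i+1}(B)` with `B` not a face.  (For `d = 3`,
`i = 1` gives removable 2-faces and `i = 2` gives removable 1-faces.) -/
def RemovableFace (d i : ℕ) (K : Complex α) (A : Finset α) : Prop :=
  A ∈ K ∧ A.card = d - i + 1 ∧
    ∃ B : Finset α, B.card = i + 1 ∧ B ∉ K ∧ link K A = stdSphere B

/-- The bistellar `i`-move (`0 < i ≤ d`) relation on weak `d`-pseudomanifolds: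
`L` is obtained from `K` by removing a removable `(d-i)`-face `A` with
`link K A = stdSphere B` and inserting the facets `(B ∪ A) \ {v}`, `v ∈ A`. -/
def BMove (d i : ℕ) (K L : Complex α) : Prop :=
  ∃ A B : Finset α, A ∈ K ∧ A.card = d - i + 1 ∧ B.card = i + 1 ∧ B ∉ K ∧
    link K A = stdSphere B ∧
    L = genCx ((facets K d).filter (fun σ => ¬ A ⊆ σ) ∪
          A.image fun v => (B ∪ A).erase v)

/-- The bistellar `0`-move: star a new vertex `w` in a facet `σ`. -/
def BMove0 (d : ℕ) (K L : Complex α) : Prop :=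
  ∃ σ w, σ ∈ K ∧ σ.card = d + 1 ∧ w ∉ verts K ∧
    L = genCx (((facets K d).erase σ) ∪ σ.image fun v => insert w (σ.erase v))

/-- A single bistellar move of any type `0 ≤ i ≤ d`. -/
def BStep (d : ℕ) (K L : Complex α) : Prop :=
  BMove0 d K L ∨ ∃ i, 0 < i ∧ i ≤ d ∧ BMove d i K L

/-- Bistellar equivalence: a finite sequence of bistellar moves. -/
def BEquiv (d : ℕ) : Complex α → Complex α → Prop :=
  Relation.ReflTransGen (BStep d)

/-- A proper bistellar move: a bistellar `i`-move with `0 < i < d`. -/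
def PMove (d : ℕ) (K L : Complex α) : Prop := ∃ i, 0 < i ∧ i < d ∧ BMove d i K L

/-- Proper bistellar equivalence. -/
def PEquiv (d : ℕ) : Complex α → Complex α → Prop :=
  Relation.ReflTransGen (PMove d)

/-- The result of the bistellar move on the face `A` of the weak
`d`-pseudomanifold `K` (deterministic form: `B` is the vertex set of
`link K A`). -/
def kappa (d : ℕ) (K : Complex α) (A : Finset α) : Complex α :=
  genCx ((facets K d).filter (fun σ => ¬ A ⊆ σ) ∪
    A.image fun v => (verts (link K A) ∪ A).erase v)

/-- A cycle: a (finite) 1-pseudomanifold. -/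
def Cycle (K : Complex α) : Prop := IsPM K 1

/-- A combinatorial 2-manifold: a weak 2-pseudomanifold all whose vertex
links are cycles. -/
def Comb2Mfd (K : Complex α) : Prop :=
  WeakPM K 2 ∧ ∀ v, ({v} : Finset α) ∈ K → Cycle (link K {v})

/-- The Euler characteristic `f₀ - f₁ + f₂` of a 2-dimensional complex. -/
def eulerChar (K : Complex α) : ℤ :=
  ((K.filter fun σ => σ.card = 1).card : ℤ) -
    ((K.filter fun σ => σ.card = 2).card : ℤ) +
    ((K.filter fun σ => σ.card = 3).card : ℤ)

/-- A combinatorial 2-sphere: a connected combinatorial 2-manifold with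
Euler characteristic 2. -/
def Comb2Sphere (K : Complex α) : Prop := Comb2Mfd K ∧ Conn K ∧ eulerChar K = 2

/-- A combinatorial 3-manifold: a 3-pseudomanifold all whose vertex links are
combinatorial 2-spheres. -/
def Comb3Mfd (K : Complex α) : Prop :=
  IsPM K 3 ∧ ∀ v, ({v} : Finset α) ∈ K → Comb2Sphere (link K {v})

end NPM

/-- The complex `N5` from the paper, generated by its facets. -/
def N5 : NPM.Complex ℕ :=
  NPM.genCx {{1,2,5,8}, {1,2,6,8}, {1,3,5,8}, {1,3,7,8}, {1,4,6,8}, {1,4,7,8}, {2,3,6,8}, {2,3,7,8}, {2,4,5,8}, {2,4,7,8}, {3,4,5,8}, {3,4,6,8}, {1,2,5,7}, {1,2,6,7}, {1,3,6,7}, {1,4,5,7}, {2,3,5,7}, {2,4,6,7}, {3,4,5,7}, {3,4,6,7}, {2,3,5,6}, {2,4,5,6}, {1,3,5,6}, {1,4,5,6}}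
/-- The complex `N6` from the paper, generated by its facets. -/
def N6 : NPM.Complex ℕ :=
  NPM.genCx {{1,3,5,8}, {1,3,7,8}, {1,4,6,8}, {1,4,7,8}, {1,5,6,8}, {2,3,6,8}, {2,3,7,8}, {2,4,5,8}, {2,4,7,8}, {2,5,6,8}, {3,4,5,8}, {3,4,6,8}, {1,2,3,5}, {1,2,4,5}, {1,4,5,7}, {1,5,6,7}, {2,3,5,7}, {2,5,6,7}, {3,4,5,7}, {1,2,3,6}, {1,2,4,6}, {1,3,6,7}, {2,4,6,7}, {3,4,6,7}}
/-- The complex `N7` from the paper, generated by its facets. -/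
def N7 : NPM.Complex ℕ :=
  NPM.genCx {{1,2,6,8}, {1,2,5,8}, {1,3,5,8}, {1,3,7,8}, {1,4,7,8}, {1,4,6,8}, {2,3,7,8}, {2,3,6,8}, {2,4,5,8}, {2,4,7,8}, {3,4,6,8}, {3,4,5,8}, {1,3,5,6}, {1,3,6,7}, {2,3,5,7}, {2,3,5,6}, {3,4,6,7}, {3,4,5,7}, {1,2,5,6}, {1,4,6,7}, {2,4,5,7}}
/-- `N_8 = κ_{348}(κ_{238}(κ_{56}(κ_{67}(N_7))))`. -/
def N8 : NPM.Complex ℕ :=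
  NPM.kappa 3 (NPM.kappa 3 (NPM.kappa 3 (NPM.kappa 3 N7 {6,7}) {5,6}) {2,3,8}) {3,4,8}
/-- `N_9 = κ_{235}(κ_{67}(N_7))`. -/
def N9 : NPM.Complex ℕ := NPM.kappa 3 (NPM.kappa 3 N7 {6,7}) {2,3,5}
/-- `N_10 = κ_{148}(κ_{67}(N_7))`. -/
def N10 : NPM.Complex ℕ := NPM.kappa 3 (NPM.kappa 3 N7 {6,7}) {1,4,8}
/-- `N_11 = κ_{348}(κ_{56}(N_10))`. -/
def N11 : NPM.Complex ℕ := NPM.kappa 3 (NPM.kappa 3 N10 {5,6}) {3,4,8}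
/-- `N_12 = κ_{457}(κ_{23}(N_9))`. -/
def N12 : NPM.Complex ℕ := NPM.kappa 3 (NPM.kappa 3 N9 {2,3}) {4,5,7}
/-- `N_13 = κ_{567}(κ_{23}(N_9))`. -/
def N13 : NPM.Complex ℕ := NPM.kappa 3 (NPM.kappa 3 N9 {2,3}) {5,6,7}
/-- `N_14 = κ_{138}(κ_{57}(N_8))`. -/
def N14 : NPM.Complex ℕ := NPM.kappa 3 (NPM.kappa 3 N8 {5,7}) {1,3,8}
/-- `N_15 = κ_{158}(κ_{23}(N_9))`. -/
def N15 : NPM.Complex ℕ := NPM.kappa 3 (NPM.kappa 3 N9 {2,3}) {1,5,8}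
/-- The 7-vertex torus `T`. -/
def T7 : NPM.Complex ℕ :=
  NPM.genCx {{1,2,4}, {1,2,6}, {1,3,4}, {1,3,7}, {1,5,6}, {1,5,7}, {2,3,5}, {2,3,7}, {2,4,5}, {2,6,7}, {3,4,6}, {3,5,6}, {4,5,7}, {4,6,7}}

namespace NPM.Search

/-- The set of numbers below `8` coded by `n`. -/
def bits (n : ℕ) : Finset ℕ := (Finset.range 8).filter fun i => n.testBit i

/-- Binary digit `n` of `s`, in a form that the kernel evaluates quickly. -/
def tb (s n : ℕ) : Bool := Nat.beq (Nat.land (Nat.shiftRight s n) 1) 1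

/-- The codes of the 4-subsets of `{0, …, 7}`; a set of small numbers is coded by its
binary characteristic number. -/
def tets : List ℕ :=
  [15, 23, 27, 29, 30, 39, 43, 45, 46, 51, 53, 54, 57, 58, 60, 71, 75, 77, 78, 83, 85, 86, 89, 90,
   92, 99, 101, 102, 105, 106, 108, 113, 114, 116, 120, 135, 139, 141, 142, 147, 149, 150, 153,
   154, 156, 163, 165, 166, 169, 170, 172, 177, 178, 180, 184, 195, 197, 198, 201, 202, 204, 209,
   210, 212, 216, 225, 226, 228, 232, 240]

/-- The 4-sets containing the set `k`. -/
def star (k : ℕ) : List ℕ := tets.filter fun n => Nat.beq (Nat.land k n) k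

/-- The sets obtained from `t` by adding one element. -/
def ext (t : ℕ) : List ℕ :=
  ((List.range 8).filter fun i => !tb t i).map fun i => Nat.lor t (Nat.pow 2 i)

/-- The unions of `k` with the sets obtained from `t` by removing one element. -/
def joins (k t : ℕ) : List ℕ :=
  ((List.range 8).filter (tb t)).map fun i => Nat.lor k (Nat.xor t (Nat.pow 2 i))

/-- The code of a set of codes. -/
def maskOf : List ℕ → ℕ
  | [] => 0
  | x :: l => Nat.lor (Nat.pow 2 x) (maskOf l)

/-- The number of binary digits `1` of `y`, cut off at `f`. This function and the next one are
written with recursors because the kernel evaluates these faster than compiled matches. -/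
noncomputable def pop (f : ℕ) : ℕ → ℕ :=
  Nat.rec (motive := fun _ => ℕ → ℕ) (fun _ => 0)
    (fun _ ih y => Nat.rec (motive := fun _ => ℕ) 0
      (fun z _ => Nat.succ (ih (Nat.land (Nat.succ z) z))) y) f

/-- No triangle lies in more than two of the 4-sets of `s`, and no completely decided
one in exactly one of them. A triangle is given by the 4-sets containing it. -/
noncomputable def consistent (cs : List (ℕ × Bool)) (s : ℕ) : Bool :=
  List.rec (motive := fun _ => Bool) true (fun c _ ih =>
    Nat.rec (motive := fun _ => Bool) ih
      (fun m _ => Nat.rec (motive := fun _ => Bool)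
        (Bool.rec (motive := fun _ => Bool) ih false c.2)
        (fun m _ => Nat.rec (motive := fun _ => Bool) ih (fun _ _ => false) m) m)
      (pop 3 (Nat.land s c.1))) cs

/-- The triangles of the 4-set `x`, each given by the 4-sets of `D` containing it and
a flag telling whether these are all of them. -/
def checks (x D : ℕ) : List (ℕ × Bool) :=
  ((List.range 8).filter (tb x)).map fun i =>
    let T := maskOf (ext (Nat.xor x (Nat.pow 2 i)))
    (Nat.land T D, Nat.beq (Nat.land T D) T)

/-- The decisions to be made, in the given order, and the triangles to be checked. -/
def steps : List ℕ → ℕ → List (ℕ × List (ℕ × Bool))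
  | [], _ => []
  | x :: l, D =>
    (x, checks x (Nat.lor D (Nat.pow 2 x))) :: steps l (Nat.lor D (Nat.pow 2 x))

/-- The depth-first search for all sets of 4-sets subject to `consistent`. -/
noncomputable def enum : List (ℕ × List (ℕ × Bool)) → ℕ → List ℕ
  | [], s => [s]
  | (x, cs) :: l, s =>
    (bif consistent cs s then enum l s else []) ++
      (bif consistent cs (Nat.lor s (Nat.pow 2 x)) then enum l (Nat.lor s (Nat.pow 2 x)) else [])

/-- The image of the set coded by `n` under the map `i ↦ ps[i]`. -/
def ap : List ℕ → ℕ → ℕ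
  | [], _ => 0
  | p :: ps, n => bif tb n 0 then Nat.lor (Nat.pow 2 p) (ap ps (n / 2)) else ap ps (n / 2)

/-- What to do with a completed search branch: it is discarded if the link of the pair `k` is
disconnected, having the triangle `t` as a component and meeting `n` outside of it; otherwise
it is carried to a target by a permutation. -/
inductive Cert
  | split (k t n : ℕ)
  | iso (ps : List ℕ) (j : ℕ)

/-- Validity of a certificate for the set `s` of 4-sets containing `k₀`. -/
def certOK (k₀ : ℕ) (targets : List ℕ) (fix : Bool) (s : ℕ) : Cert → Bool
  | .split k t n =>
    (bits k).card == 2 && (bits t).card == 3 && Nat.land k t == 0 &&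
      ((joins k t).all fun m => (star k₀).contains m && tb s m) &&
      (star k₀).contains n && (star k).contains n && tb s n && Nat.land n t == 0
  | .iso ps j =>
    match targets[j]? with
    | none => false
    | some C =>
      ((List.range 8).all fun i => ps.contains i) && ps.length == 8 &&
      (!fix || ps.getD 7 0 == 7) &&
      (star k₀).all fun n => Nat.land k₀ (ap ps n) == k₀ && tb s (ap ps n) == tb C n

def certsOK (k₀ : ℕ) (targets : List ℕ) (fix : Bool) : List ℕ → List Cert → Bool
  | [], _ => true
  | _ :: _, [] => false
  | s :: l, c :: cs => certOK k₀ targets fix s c && certsOK k₀ targets fix l cs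

/-- None of the prescribed counts `p.2` of 4-sets containing `p.1` occurs. -/
noncomputable def admissible (forb : List (ℕ × ℕ)) (s : ℕ) : Bool :=
  forb.all fun p => !Nat.beq (pop 36 (Nat.land s (maskOf (star p.1)))) p.2

/-- Given the 4-sets containing `k₁`, coded by `s₀`, the search over `order` shows that those
containing `k₀` may be assumed to be one of the targets. -/
noncomputable def searchOK (k₀ k₁ : ℕ) (order : List ℕ) (s₀ : ℕ) (forb : List (ℕ × ℕ))
    (targets : List ℕ) (fix : Bool) (certs : List Cert) : Bool :=
  (order.all fun n => tets.contains n) &&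
    ((star k₀).all fun n => (star k₁).contains n || order.contains n) &&
    (forb.all fun p => Nat.land k₀ p.1 == k₀) &&
    ((List.range 256).all fun n => !tb s₀ n || (star k₁).contains n) && Nat.blt s₀ (2 ^ 256) &&
    certsOK k₀ targets fix
      ((enum (steps order (maskOf (star k₁))) s₀).filter (admissible forb)) certs

end NPM.Search

namespace NPM.Search

theorem mem_bits {n i : ℕ} : i ∈ bits n ↔ i < 8 ∧ n.testBit i = true := by
  simp [bits]

theorem tb_eq (s n : ℕ) : tb s n = s.testBit n := by
  unfold tb Nat.testBit
  change Nat.beq ((s >>> n) &&& 1) 1 = ((1 &&& (s >>> n)) != 0)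
  rw [Nat.and_comm, Nat.one_and_eq_mod_two]
  rcases Nat.mod_two_eq_zero_or_one (s >>> n) with h | h <;> rw [h] <;> rfl

theorem nat_and (a b : ℕ) : Nat.land a b = a &&& b := rfl
theorem nat_or (a b : ℕ) : Nat.lor a b = a ||| b := rfl
theorem nat_xor (a b : ℕ) : Nat.xor a b = a ^^^ b := rfl
theorem nat_pow (a b : ℕ) : Nat.pow a b = a ^ b := rfl

theorem mem_tets {n : ℕ} : n ∈ tets ↔ n < 256 ∧ (bits n).card = 4 := by
  have h : ∀ n < 256, n ∈ tets ↔ (bits n).card = 4 := by decide +kernel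
  have h' : ∀ n ∈ tets, n < 256 := by decide +kernel
  exact ⟨fun hn => ⟨h' n hn, (h n (h' n hn)).1 hn⟩, fun hn => (h n hn.1).2 hn.2⟩

theorem mem_star {k n : ℕ} : n ∈ star k ↔ n ∈ tets ∧ k &&& n = k := by
  simp [star]

theorem star_subset {k₀ k : ℕ} (h : k₀ &&& k = k₀) {n : ℕ} (hn : n ∈ star k) : n ∈ star k₀ := by
  rw [mem_star] at hn ⊢
  refine ⟨hn.1, ?_⟩
  conv_lhs => rw [← h]
  rw [Nat.and_assoc, hn.2, h]

theorem testBit_two_pow' {x n : ℕ} : (2 ^ x).testBit n = true ↔ n = x := by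
  rw [Nat.testBit_two_pow, decide_eq_true_eq]
  exact eq_comm

theorem tb_maskOf (l : List ℕ) (n : ℕ) : (maskOf l).testBit n = true ↔ n ∈ l := by
  induction l with
  | nil => simp [maskOf]
  | cons x l ih =>
    rw [maskOf, nat_or, nat_pow, Nat.testBit_or, Bool.or_eq_true, ih, testBit_two_pow',
      List.mem_cons]

theorem exists_lowest (y : ℕ) (hy : y ≠ 0) :
    ∃ n, y.testBit n = true ∧
      ∀ j, (y &&& (y - 1)).testBit j = true ↔ y.testBit j = true ∧ j ≠ n := by
  induction y using Nat.strong_induction_on with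
  | _ y ih =>
    rcases Nat.even_or_odd' y with ⟨m, rfl | rfl⟩
    · obtain ⟨n, hn, h⟩ := ih m (by omega) (by omega)
      refine ⟨n + 1, by simpa [Nat.testBit_succ] using hn, fun j => ?_⟩
      have e : (2 * m - 1) / 2 = m - 1 := by omega
      cases j with
      | zero => simp
      | succ j =>
        have := h j
        rw [Nat.testBit_and] at this ⊢
        rw [Nat.testBit_succ, Nat.testBit_succ, e, Nat.mul_div_cancel_left _ two_pos]
        simpa using this
    · refine ⟨0, by simp, fun j => ?_⟩
      cases j with
      | zero => simp
      | succ j =>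
        have e : (2 * m + 1) / 2 = m := by omega
        rw [Nat.testBit_and, Nat.testBit_succ, Nat.testBit_succ, e]
        simp

theorem pop_eq (f : ℕ) : ∀ (y : ℕ) (S : Finset ℕ), (∀ j, y.testBit j = true ↔ j ∈ S) →
    pop f y = min f S.card := by
  induction f with
  | zero => intro y S _; simp [pop]
  | succ f ih =>
    intro y S h
    cases y with
    | zero =>
      have : S = ∅ := Finset.eq_empty_of_forall_notMem fun j hj => by simpa using (h j).2 hj
      subst this
      rfl
    | succ y =>
      obtain ⟨n, hn, hl⟩ := exists_lowest (y + 1) (by omega)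
      have hnS := (h n).1 hn
      have := ih (Nat.land (y + 1) y) (S.erase n) fun j => by
        rw [nat_and, Finset.mem_erase, ← h j, and_comm]
        exact hl j
      change Nat.succ (pop f (Nat.land (y + 1) y)) = _
      rw [this, Finset.card_erase_of_mem hnS]
      have := Finset.card_pos.2 ⟨n, hnS⟩
      omega

theorem consistent_cons (c : ℕ × Bool) (cs : List (ℕ × Bool)) (s : ℕ) :
    consistent (c :: cs) s = true ↔
      (pop 3 (s &&& c.1) ≤ 2 ∧ (c.2 = true → pop 3 (s &&& c.1) ≠ 1)) ∧
        consistent cs s = true := by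
  have e : consistent (c :: cs) s = Nat.rec (motive := fun _ => Bool) (consistent cs s)
      (fun m _ => Nat.rec (motive := fun _ => Bool)
        (Bool.rec (motive := fun _ => Bool) (consistent cs s) false c.2)
        (fun m _ => Nat.rec (motive := fun _ => Bool) (consistent cs s) (fun _ _ => false) m) m)
      (pop 3 (Nat.land s c.1)) := rfl
  rw [e, nat_and]
  rcases pop 3 (s &&& c.1) with _ | _ | _ | m <;> rcases c.2 with _ | _ <;> simp

/-- The 4-sets of `D` on which `P` holds are those coded by `s`. -/
def Agree (P : ℕ → Bool) (D s : ℕ) : Prop := ∀ n, D.testBit n = true → P n = s.testBit n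

/-- Every triangle of a 4-set lies in none or two of the 4-sets satisfying `P`. -/
def Closed (P : ℕ → Bool) : Prop :=
  ∀ x ∈ tets, ∀ i ∈ bits x,
    ((ext (x ^^^ 2 ^ i)).toFinset.filter fun n => P n = true).card = 0 ∨
      ((ext (x ^^^ 2 ^ i)).toFinset.filter fun n => P n = true).card = 2

theorem consistent_checks {P : ℕ → Bool} (hP : Closed P) {x D s : ℕ} (hx : x ∈ tets)
    (h : Agree P D s) : consistent (checks x D) s = true := by
  have key : ∀ l : List ℕ, (∀ i ∈ l, i ∈ bits x) → consistent (l.map fun i =>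
      (Nat.land (maskOf (ext (Nat.xor x (Nat.pow 2 i)))) D,
        Nat.beq (Nat.land (maskOf (ext (Nat.xor x (Nat.pow 2 i)))) D)
          (maskOf (ext (Nat.xor x (Nat.pow 2 i)))))) s = true := by
    intro l hl
    induction l with
    | nil => rfl
    | cons i l ih =>
      rw [List.map_cons, consistent_cons]
      refine ⟨?_, ih fun j hj => hl j (List.mem_cons_of_mem _ hj)⟩
      have hc := hP x hx i (hl i List.mem_cons_self)
      simp only [nat_and, nat_xor, nat_pow] at *
      set T := ext (x ^^^ 2 ^ i)
      have hp : pop 3 (s &&& (maskOf T &&& D)) = min 3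
          ((T.toFinset.filter fun n => P n = true).filter fun n => D.testBit n = true).card := by
        refine pop_eq _ _ _ fun j => ?_
        simp only [Nat.testBit_and, Bool.and_eq_true, tb_maskOf, Finset.mem_filter,
          List.mem_toFinset]
        constructor
        · rintro ⟨h1, h2, h3⟩
          exact ⟨⟨h2, by rw [h j h3, h1]⟩, h3⟩
        · rintro ⟨⟨h2, h1⟩, h3⟩
          exact ⟨by rw [← h j h3, h1], h2, h3⟩
      have hle := Finset.card_filter_le (T.toFinset.filter fun n => P n = true)
        fun n => D.testBit n = true
      refine ⟨by omega, fun hf => ?_⟩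
      rw [Finset.filter_true_of_mem] at hp
      · omega
      · intro n hn
        have hm := (tb_maskOf T n).2 (List.mem_toFinset.1 (Finset.mem_filter.1 hn).1)
        rw [← Nat.eq_of_beq_eq_true hf, Nat.testBit_and, Bool.and_eq_true] at hm
        exact hm.2
  refine key _ fun i hi => ?_
  simp only [List.mem_filter, List.mem_range, tb_eq] at hi
  exact mem_bits.2 hi

theorem exists_mem_enum {P : ℕ → Bool} (hP : Closed P) (l : List ℕ) :
    ∀ D s : ℕ, (∀ x ∈ l, x ∈ tets) → (∀ n, s.testBit n = true → D.testBit n = true) →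
      Agree P D s → ∃ s' ∈ enum (steps l D) s,
        ∀ n, D.testBit n = true ∨ n ∈ l → P n = s'.testBit n := by
  induction l with
  | nil => intro D s _ _ h; exact ⟨s, by simp [steps, enum], fun n hn => h n (by simpa using hn)⟩
  | cons x l ih =>
    intro D s hl hs h
    have hx := hl x List.mem_cons_self
    have hl' := fun y hy => hl y (List.mem_cons_of_mem x hy)
    simp only [steps, enum, List.mem_append, nat_or, nat_pow]
    have bit : ∀ a n : ℕ, (a ||| 2 ^ x).testBit n = true ↔ a.testBit n = true ∨ n = x := by
      intro a n
      rw [Nat.testBit_or, Bool.or_eq_true, testBit_two_pow']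
    cases hPx : P x with
    | false =>
      have h' : Agree P (D ||| 2 ^ x) s := by
        intro n hn
        rcases (bit D n).1 hn with hn | rfl
        · exact h n hn
        · rw [hPx]
          cases ht : s.testBit n with
          | false => rfl
          | true => rw [← hPx, h n (hs n ht), ht]
      obtain ⟨s', hs', h2⟩ := ih (D ||| 2 ^ x) s hl' (fun n hn => (bit D n).2 (.inl (hs n hn))) h'
      refine ⟨s', .inl ?_, fun n hn => h2 n ?_⟩
      · rw [consistent_checks hP hx h']
        exact hs'
      · rw [bit]
        rcases hn with hn | hn
        · exact .inl (.inl hn)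
        · rcases List.mem_cons.1 hn with rfl | hn
          · exact .inl (.inr rfl)
          · exact .inr hn
    | true =>
      have h' : Agree P (D ||| 2 ^ x) (s ||| 2 ^ x) := by
        intro n hn
        by_cases hnx : n = x
        · subst hnx
          rw [hPx, (bit s n).2 (.inr rfl)]
        · rw [h n (((bit D n).1 hn).resolve_right hnx), Bool.eq_iff_iff, bit]
          simp [hnx]
      obtain ⟨s', hs', h2⟩ := ih (D ||| 2 ^ x) (s ||| 2 ^ x) hl'
        (fun n hn => (bit D n).2 (((bit s n).1 hn).imp_left (hs n))) h'
      refine ⟨s', .inr ?_, fun n hn => h2 n ?_⟩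
      · rw [consistent_checks hP hx h']
        exact hs'
      · rw [bit]
        rcases hn with hn | hn
        · exact .inl (.inl hn)
        · rcases List.mem_cons.1 hn with rfl | hn
          · exact .inl (.inr rfl)
          · exact .inr hn

theorem testBit_ap (ps : List ℕ) : ∀ n j : ℕ, (ap ps n).testBit j = true ↔
    ∃ i, ∃ h : i < ps.length, n.testBit i = true ∧ ps[i] = j := by
  induction ps with
  | nil => intro n j; simp [ap]
  | cons p ps ih =>
    intro n j
    have e : (∃ i, ∃ h : i < (p :: ps).length, n.testBit i = true ∧ (p :: ps)[i] = j) ↔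
        (n.testBit 0 = true ∧ p = j) ∨ (ap ps (n / 2)).testBit j = true := by
      rw [ih]
      constructor
      · rintro ⟨_ | i, h, h1, h2⟩
        · exact .inl ⟨h1, h2⟩
        · exact .inr ⟨i, by simpa using h, by rwa [← Nat.testBit_succ], h2⟩
      · rintro (⟨h1, h2⟩ | ⟨i, h, h1, h2⟩)
        · exact ⟨0, by simp, h1, h2⟩
        · exact ⟨i + 1, by simpa using h, by rwa [Nat.testBit_succ], h2⟩
    rw [e, ap, tb_eq]
    cases n.testBit 0 <;>
      simp [Nat.testBit_or, Nat.testBit_two_pow]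

theorem exists_certOK {k₀ : ℕ} {targets : List ℕ} {fix : Bool} : ∀ {l : List ℕ} {cs : List Cert},
    certsOK k₀ targets fix l cs = true → ∀ s ∈ l, ∃ c, certOK k₀ targets fix s c = true
  | [], _, _, s, hs => by simp at hs
  | _ :: _, [], h, _, _ => by simp [certsOK] at h
  | a :: l, c :: cs, h, s, hs => by
    simp only [certsOK, Bool.and_eq_true] at h
    rcases List.mem_cons.1 hs with rfl | hs
    · exact ⟨c, h.1⟩
    · exact exists_certOK h.2 s hs

end NPM.Search

namespace NPM.Search

/-- The six facets of a link of the edge `67` that is the 6-cycle `0, …, 5`. -/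
def hexagon : ℕ := 1766901090010173259453165218114787809075193043681874057308205758673846272

/-- The three facets of a link of the edge `67` that is the 3-cycle `0, 1, 2`. -/
def triangle : ℕ := 652818580480214799438922100013597307274644966224259589341184

/-- The cone over the 7-vertex torus with apex `7`. -/
def torus : ℕ := 7009692269105717061055774731891873376917880866561602038924756568244224

/-- The cone with apex `7` over a 7-vertex projective plane. -/
def plane0 : ℕ := 1766901090010173260993155363640120313599406544645213820893157821444521984

/-- The cone with apex `7` over a 7-vertex projective plane. -/
def plane1 : ℕ := 1766901090010173259843117250577257505334551449606475329257871039170347008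

/-- The cone with apex `7` over a 7-vertex projective plane. -/
def plane2 : ℕ := 1766901090010173260985707540059494045418622831296381597994298035379634176

/-- The facets of `N5, …, N15`, the vertices being renamed to `0, …, 7`. -/
def finals : List ℕ :=
  [10244230038991005741133858414292389908843975720714825885548544,
   10244230613665141374337571518235057795499887772605237421932544,
   10244230038991005741133858414251191873635170920845522669404160,
   539198943185534370163855038950463275015840960795614253437178607566848,
   10244230038991005741133858517734580895446313136763739465318400,
   6955666247155219016748826244187576648919909440547728269241694573035520,
   6955666247155245063186618913938457206424690190695910895256000295600128,
   539198943185508323726062369199582821351920589545106290414698018897920,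
   539198943185508323726062369199582717511060210647431627422872885002240,
   539206347755175060058670238245193168570521300565158305910296661721088,
   539198943185508323726062904461023729052762221752369300388089448890368]

/-- An order of the 4-sets avoiding `7` in which few branches survive for long. -/
def order : List ℕ :=
  [15, 23, 39, 71, 27, 43, 75, 51, 83, 99, 29, 45, 77, 53, 85, 101, 57, 89, 105, 113, 30, 46, 78,
   54, 86, 102, 58, 90, 106, 114, 60, 92, 108, 116, 120]

def hexCerts : List Cert :=
  [.iso [5, 1, 3, 2, 4, 0, 6, 7] 0, .iso [5, 2, 3, 1, 4, 0, 6, 7] 0,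
   .iso [5, 1, 4, 2, 3, 0, 6, 7] 0, .iso [4, 1, 5, 2, 3, 0, 6, 7] 0,
   .iso [5, 2, 4, 1, 3, 0, 6, 7] 0, .iso [4, 2, 5, 1, 3, 0, 6, 7] 0,
   .iso [5, 1, 2, 3, 4, 0, 6, 7] 0, .iso [5, 3, 2, 1, 4, 0, 6, 7] 0,
   .iso [5, 2, 1, 3, 4, 0, 6, 7] 0, .iso [5, 3, 1, 2, 4, 0, 6, 7] 0, .split 192 49 198,
   .iso [5, 1, 2, 4, 3, 0, 6, 7] 0, .iso [5, 2, 1, 4, 3, 0, 6, 7] 0, .split 192 41 198,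
   .split 192 25 198, .iso [4, 2, 1, 5, 3, 0, 6, 7] 0, .iso [4, 1, 2, 5, 3, 0, 6, 7] 0,
   .iso [5, 4, 1, 2, 3, 0, 6, 7] 0, .iso [4, 5, 1, 2, 3, 0, 6, 7] 0,
   .iso [5, 4, 2, 1, 3, 0, 6, 7] 0, .iso [4, 5, 2, 1, 3, 0, 6, 7] 0,
   .iso [5, 1, 4, 3, 2, 0, 6, 7] 0, .iso [4, 1, 5, 3, 2, 0, 6, 7] 0,
   .iso [5, 1, 3, 4, 2, 0, 6, 7] 0, .split 192 37 202, .iso [5, 3, 1, 4, 2, 0, 6, 7] 0,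
   .iso [4, 3, 1, 5, 2, 0, 6, 7] 0, .split 192 21 202, .iso [4, 1, 3, 5, 2, 0, 6, 7] 0,
   .iso [5, 4, 1, 3, 2, 0, 6, 7] 0, .iso [4, 5, 1, 3, 2, 0, 6, 7] 0,
   .iso [3, 4, 1, 5, 2, 0, 6, 7] 0, .iso [3, 5, 1, 4, 2, 0, 6, 7] 0, .split 192 13 210,
   .iso [3, 1, 5, 4, 2, 0, 6, 7] 0, .iso [3, 1, 4, 5, 2, 0, 6, 7] 0,
   .iso [5, 3, 4, 1, 2, 0, 6, 7] 0, .iso [4, 3, 5, 1, 2, 0, 6, 7] 0,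
   .iso [5, 4, 3, 1, 2, 0, 6, 7] 0, .iso [4, 5, 3, 1, 2, 0, 6, 7] 0,
   .iso [3, 4, 5, 1, 2, 0, 6, 7] 0, .iso [3, 5, 4, 1, 2, 0, 6, 7] 0, .split 192 35 204,
   .iso [5, 2, 3, 4, 1, 0, 6, 7] 0, .iso [5, 3, 2, 4, 1, 0, 6, 7] 0,
   .iso [4, 3, 2, 5, 1, 0, 6, 7] 0, .iso [4, 2, 3, 5, 1, 0, 6, 7] 0, .split 192 19 204,
   .iso [5, 2, 4, 3, 1, 0, 6, 7] 0, .iso [4, 2, 5, 3, 1, 0, 6, 7] 0,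
   .iso [5, 4, 2, 3, 1, 0, 6, 7] 0, .iso [4, 5, 2, 3, 1, 0, 6, 7] 0,
   .iso [3, 4, 2, 5, 1, 0, 6, 7] 0, .iso [3, 5, 2, 4, 1, 0, 6, 7] 0,
   .iso [3, 2, 4, 5, 1, 0, 6, 7] 0, .iso [3, 2, 5, 4, 1, 0, 6, 7] 0, .split 192 11 212,
   .iso [5, 3, 4, 2, 1, 0, 6, 7] 0, .iso [4, 3, 5, 2, 1, 0, 6, 7] 0,
   .iso [5, 4, 3, 2, 1, 0, 6, 7] 0, .iso [4, 5, 3, 2, 1, 0, 6, 7] 0,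
   .iso [3, 4, 5, 2, 1, 0, 6, 7] 0, .iso [3, 5, 4, 2, 1, 0, 6, 7] 0,
   .iso [2, 4, 3, 5, 1, 0, 6, 7] 0, .iso [2, 5, 3, 4, 1, 0, 6, 7] 0,
   .iso [2, 3, 4, 5, 1, 0, 6, 7] 0, .iso [2, 3, 5, 4, 1, 0, 6, 7] 0,
   .iso [2, 5, 4, 3, 1, 0, 6, 7] 0, .iso [2, 4, 5, 3, 1, 0, 6, 7] 0, .split 192 7 216]

def triCerts : List Cert :=
  [.iso [5, 4, 3, 2, 1, 0, 6, 7] 0, .iso [5, 4, 2, 3, 1, 0, 6, 7] 0,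
   .iso [5, 4, 1, 3, 2, 0, 6, 7] 0, .iso [5, 4, 0, 3, 2, 1, 6, 7] 0,
   .iso [5, 3, 2, 4, 1, 0, 6, 7] 0, .iso [4, 3, 2, 5, 1, 0, 6, 7] 0,
   .iso [5, 3, 1, 4, 2, 0, 6, 7] 0, .iso [4, 3, 1, 5, 2, 0, 6, 7] 0,
   .iso [5, 3, 0, 4, 2, 1, 6, 7] 0, .iso [4, 3, 0, 5, 2, 1, 6, 7] 0,
   .iso [5, 2, 1, 4, 3, 0, 6, 7] 0, .iso [4, 2, 1, 5, 3, 0, 6, 7] 0,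
   .iso [3, 2, 1, 5, 4, 0, 6, 7] 0, .iso [5, 2, 0, 4, 3, 1, 6, 7] 0,
   .iso [4, 2, 0, 5, 3, 1, 6, 7] 0, .iso [3, 2, 0, 5, 4, 1, 6, 7] 0,
   .iso [5, 1, 0, 4, 3, 2, 6, 7] 0, .iso [4, 1, 0, 5, 3, 2, 6, 7] 0,
   .iso [3, 1, 0, 5, 4, 2, 6, 7] 0, .iso [2, 1, 0, 5, 4, 3, 6, 7] 0]

def starTriCerts : List Cert :=
  [.split 129 70 153, .split 130 69 154, .split 132 67 156]

def torusCerts : List Cert :=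
  [.iso [2, 6, 5, 3, 4, 1, 0, 7] 0, .iso [3, 4, 2, 6, 5, 1, 0, 7] 0]

def rpCerts : List Cert :=
  [.iso [5, 6, 1, 3, 2, 4, 0, 7] 0, .split 160 81 166, .split 160 81 166, .split 129 98 141,
   .iso [5, 2, 3, 4, 1, 6, 0, 7] 1, .iso [2, 5, 4, 3, 0, 6, 1, 7] 1,
   .iso [3, 6, 1, 5, 0, 4, 2, 7] 0, .iso [2, 6, 0, 4, 5, 3, 1, 7] 0, .split 130 69 154,
   .split 136 35 156, .iso [4, 1, 2, 3, 0, 6, 5, 7] 1, .iso [6, 2, 5, 4, 3, 0, 1, 7] 2,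
   .split 130 69 154, .split 132 49 142, .iso [6, 5, 2, 3, 4, 1, 0, 7] 2, .split 132 49 142,
   .iso [3, 0, 5, 4, 1, 6, 2, 7] 1, .split 129 98 141, .split 136 35 156,
   .iso [1, 6, 5, 3, 4, 2, 0, 7] 0, .iso [5, 2, 1, 0, 3, 6, 4, 7] 1,
   .iso [4, 1, 0, 5, 2, 6, 3, 7] 1, .iso [0, 6, 2, 4, 3, 5, 1, 7] 0, .split 144 7 184,
   .iso [4, 6, 2, 0, 1, 5, 3, 7] 0, .split 144 7 184]

def finCerts0 : List Cert :=
  [.split 33 194 45, .split 65 162 77, .split 65 162 77, .split 33 194 45, .split 33 194 45,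
   .split 48 11 116, .split 80 7 120, .split 18 97 30, .split 18 97 30,
   .iso [1, 0, 7, 4, 5, 3, 2, 6] 10, .split 24 37 90, .split 68 49 78,
   .iso [2, 0, 7, 1, 5, 4, 6, 3] 7, .split 72 35 92, .split 80 7 120,
   .iso [2, 0, 7, 4, 3, 5, 1, 6] 4, .split 34 137 54, .split 80 7 120, .split 34 137 54,
   .iso [2, 0, 7, 6, 5, 3, 1, 4] 7, .iso [1, 0, 7, 4, 6, 2, 3, 5] 10,
   .iso [3, 0, 7, 1, 6, 4, 5, 2] 7, .split 40 81 46, .split 20 73 54, .split 48 11 116,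
   .split 66 133 90, .iso [3, 0, 7, 4, 2, 6, 1, 5] 4, .iso [3, 0, 7, 5, 6, 2, 1, 4] 7,
   .split 66 133 90, .split 48 11 116, .iso [5, 0, 7, 2, 1, 3, 4, 6] 10,
   .iso [2, 0, 7, 3, 1, 6, 5, 4] 8, .iso [6, 0, 7, 3, 1, 2, 4, 5] 10,
   .iso [2, 3, 7, 4, 6, 5, 1, 0] 9, .iso [4, 0, 7, 5, 1, 2, 6, 3] 7,
   .iso [4, 0, 7, 6, 1, 3, 5, 2] 7, .split 36 67 60, .split 68 49 78, .split 96 145 102,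
   .iso [3, 0, 7, 2, 4, 6, 5, 1] 4, .split 40 81 46, .split 36 67 60, .split 72 35 92,
   .iso [4, 0, 7, 2, 6, 5, 1, 3] 8, .iso [4, 0, 7, 3, 5, 6, 1, 2] 8, .split 12 19 108,
   .split 12 19 108, .iso [5, 0, 7, 2, 6, 4, 3, 1] 10, .split 40 81 46, .split 20 73 54,
   .split 6 41 86, .split 10 69 58, .split 12 19 108, .split 6 41 86, .split 6 41 86,
   .split 6 41 86, .split 10 69 58, .split 10 69 58, .split 10 69 58, .split 68 49 78,
   .iso [6, 0, 7, 3, 5, 4, 2, 1] 10, .split 24 37 90, .split 3 28 99, .split 3 28 99,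
   .split 3 28 99, .split 3 28 99]

def finCerts1 : List Cert :=
  [.split 36 81 46, .split 80 7 120, .split 68 49 78, .iso [6, 0, 7, 2, 5, 1, 3, 4] 6,
   .split 36 81 46, .split 18 161 30, .split 18 161 30, .iso [0, 2, 7, 4, 5, 3, 1, 6] 5,
   .split 17 138 53, .iso [4, 2, 7, 0, 6, 3, 1, 5] 5, .split 17 138 53,
   .iso [5, 0, 7, 2, 6, 3, 1, 4] 6, .split 36 81 46, .split 66 133 90,
   .iso [6, 1, 3, 5, 2, 0, 4, 7] 7, .split 48 13 114, .iso [5, 3, 1, 6, 2, 0, 4, 7] 7,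
   .split 40 133 58, .split 68 49 78, .split 24 193 30, .iso [2, 7, 3, 1, 6, 5, 4, 0] 1,
   .iso [5, 4, 7, 2, 6, 1, 3, 0] 6, .split 36 81 46, .iso [5, 1, 3, 6, 2, 4, 0, 7] 8,
   .iso [6, 4, 2, 0, 3, 5, 1, 7] 3, .split 17 138 53, .split 9 70 57, .split 33 22 105,
   .split 33 22 105, .split 3 44 83, .split 3 44 83, .split 3 44 83, .split 3 44 83,
   .iso [6, 3, 1, 5, 2, 4, 0, 7] 8, .split 9 70 57, .split 9 70 57, .split 9 70 57,
   .split 68 49 78, .iso [6, 4, 7, 2, 5, 3, 1, 0] 6, .iso [5, 1, 3, 6, 2, 4, 0, 7] 7,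
   .split 72 35 92, .split 6 25 102, .split 65 162 77, .split 65 162 77, .split 34 73 54,
   .iso [6, 3, 1, 5, 2, 4, 0, 7] 7, .split 6 25 102]

def finCerts2 : List Cert :=
  [.split 12 193 30, .iso [0, 2, 6, 4, 5, 3, 1, 7] 4, .split 24 193 30, .split 96 145 102,
   .iso [0, 2, 4, 6, 3, 5, 1, 7] 4, .split 36 145 46, .split 48 11 116,
   .iso [4, 3, 7, 1, 6, 0, 2, 5] 3, .iso [3, 1, 7, 5, 6, 2, 0, 4] 2, .split 48 11 116,
   .iso [0, 6, 4, 2, 1, 5, 3, 7] 4, .split 36 145 46, .split 33 26 101, .split 33 26 101,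
   .split 33 26 101, .split 96 145 102, .iso [4, 2, 0, 6, 1, 5, 3, 7] 4, .split 24 193 30,
   .split 9 98 29, .split 9 98 29, .split 9 98 29, .iso [2, 4, 6, 0, 1, 5, 3, 7] 4,
   .split 12 193 30, .split 72 35 92, .iso [5, 1, 7, 3, 4, 2, 0, 6] 2,
   .iso [6, 5, 7, 1, 4, 0, 2, 3] 3, .split 72 35 92, .iso [2, 0, 6, 4, 3, 5, 1, 7] 4,
   .iso [2, 0, 4, 6, 5, 3, 1, 7] 4, .iso [6, 3, 7, 1, 4, 2, 0, 5] 3,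
   .iso [6, 3, 7, 5, 2, 4, 0, 1] 3, .iso [4, 5, 7, 1, 6, 2, 0, 3] 3,
   .iso [6, 0, 2, 4, 1, 5, 3, 7] 4, .split 12 193 30, .split 66 133 90, .split 66 133 90,
   .iso [6, 4, 0, 2, 5, 3, 1, 7] 4, .split 12 193 30, .split 18 133 58, .split 18 133 58,
   .iso [4, 6, 2, 0, 5, 3, 1, 7] 4, .split 18 133 58, .split 9 98 29, .split 9 98 29,
   .split 9 98 29, .split 33 26 101, .split 33 26 101, .split 33 26 101, .split 66 133 90,
   .iso [6, 4, 2, 0, 3, 5, 1, 7] 4, .split 24 193 30, .iso [5, 3, 7, 1, 6, 4, 2, 0] 2,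
   .split 6 41 86, .split 6 41 86, .iso [5, 3, 7, 1, 6, 4, 2, 0] 0, .split 72 35 92,
   .split 3 44 83, .split 3 44 83, .split 3 44 83, .split 3 44 83, .split 3 44 83,
   .split 3 44 83, .iso [2, 3, 7, 5, 6, 0, 4, 1] 3, .split 6 41 86, .split 6 41 86,
   .iso [3, 5, 7, 1, 6, 4, 0, 2] 2, .split 36 145 46, .split 18 133 58,
   .iso [4, 6, 0, 2, 3, 5, 1, 7] 4, .split 18 133 58, .split 36 145 46]

/-- Every vertex different from `7` is joined to `7`. -/
def cone : List (ℕ × ℕ) := (List.range 7).map fun i => (128 + 2 ^ i, 0)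

/-- Any two vertices are joined, and no vertex is in 14 facets. -/
def neighbourly : List (ℕ × ℕ) :=
  (((List.range 256).filter fun k => (bits k).card == 2).map fun k => (k, 0)) ++
    (List.range 8).map fun i => (2 ^ i, 14)

def starOrder : List ℕ := ((star 128).filter fun n => Nat.beq (Nat.land n 64) 0).reverse

theorem edge_search :
    searchOK 192 255 (star 192) 0 [(192, 0), (192, 3), (192, 4), (192, 5), (192, 6)] [] true
      [] := by
  decide +kernel

theorem hexagon_search :
    searchOK 192 255 (star 192) 0 [(192, 0), (192, 3), (192, 4), (192, 5)] [hexagon] true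
      hexCerts := by
  decide +kernel

theorem triangle_search :
    searchOK 192 255 (star 192) 0 [(192, 0), (192, 4), (192, 5), (192, 6)] [triangle] true
      triCerts := by
  decide +kernel

theorem eight_search :
    searchOK 128 192 starOrder triangle (cone ++ [(128, 10), (128, 12), (128, 14)]) [] true
      starTriCerts := by
  decide +kernel

theorem torus_search :
    searchOK 128 192 starOrder hexagon (cone ++ [(128, 10), (128, 12)]) [torus] true
      torusCerts := by
  decide +kernel

theorem plane_search :
    searchOK 128 192 starOrder hexagon (cone ++ [(128, 10), (128, 14)])
      [plane0, plane1, plane2] true rpCerts := by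
  decide +kernel

theorem plane0_search :
    searchOK 0 128 order plane0 neighbourly finals false finCerts0 := by
  decide +kernel

theorem plane1_search :
    searchOK 0 128 order plane1 neighbourly finals false finCerts1 := by
  decide +kernel

theorem plane2_search :
    searchOK 0 128 order plane2 neighbourly finals false finCerts2 := by
  decide +kernel

end NPM.Search

namespace NPM

variable {α : Type*} [DecidableEq α]

theorem mem_verts {K : Complex α} {v : α} : v ∈ verts K ↔ ∃ σ ∈ K, v ∈ σ := by
  simp [verts, Finset.mem_sup]

theorem subset_verts {K : Complex α} {σ : Finset α} (h : σ ∈ K) : σ ⊆ verts K :=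
  Finset.le_sup (f := id) h

theorem IsComplex.singleton_mem {K : Complex α} (hK : IsComplex K) {v : α} :
    {v} ∈ K ↔ v ∈ verts K := by
  rw [mem_verts]
  refine ⟨fun h => ⟨_, h, by simp⟩, ?_⟩
  rintro ⟨σ, h, hv⟩
  exact hK.2.2 σ h {v} (by simpa using hv) (by simp)

theorem mem_link {K : Complex α} {σ τ : Finset α} :
    τ ∈ link K σ ↔ τ ∈ K ∧ Disjoint τ σ ∧ σ ∪ τ ∈ K := by
  simp [link]

theorem IsComplex.mem_link {K : Complex α} (hK : IsComplex K) {σ τ : Finset α} :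
    τ ∈ link K σ ↔ τ.Nonempty ∧ Disjoint τ σ ∧ σ ∪ τ ∈ K := by
  rw [NPM.mem_link]
  exact ⟨fun h => ⟨hK.2.1 _ h.1, h.2⟩,
    fun h => ⟨hK.2.2 _ h.2.2 _ Finset.subset_union_right h.1, h.2⟩⟩

/-- If the link of a pair contains a triangle, it contains nothing else. -/
theorem NormalPM.not_disjoint_triangle {K : Complex α} (hK : NormalPM K 3) {A B σ : Finset α}
    (hA : A.card = 2) (hB : B.card = 3) (hAB : Disjoint A B)
    (hj : ∀ x ∈ B, A ∪ B.erase x ∈ K) (hσ : σ ∈ K) (hAσ : A ⊆ σ) (hσ4 : σ.card = 4) :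
    ¬ Disjoint σ B := by
  intro hσB
  have hC := hK.1.1
  have hAK : A ∈ K := hC.2.2 σ hσ A hAσ (Finset.card_pos.1 (by omega))
  have step : ∀ a ∈ B, ∀ b, a ≠ b → {a, b} ∈ link K A → b ∈ B := by
    intro a ha b hab hl
    by_contra hb
    rw [mem_link] at hl
    have haA : a ∉ A := Finset.disjoint_right.1 hAB ha
    have hbA : b ∉ A := Finset.disjoint_left.1 hl.2.1 (by simp)
    have hcard : (insert a A).card = 3 := by rw [Finset.card_insert_of_notMem haA, hA]
    have hmem : insert a A ∈ K :=
      hC.2.2 _ hl.2.2 _ (by intro x; simp; tauto) (by simp)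
    have h2 := hK.1.2.2 _ hmem hcard
    have hinj : Set.InjOn (fun x => A ∪ B.erase x) ↑(B.erase a) := by
      intro x hx y hy hxy
      by_contra hne
      have hx' := Finset.mem_of_mem_erase hx
      have : x ∈ A ∪ B.erase y := by simp [hne, hx']
      rw [← (show A ∪ B.erase x = A ∪ B.erase y from hxy)] at this
      simp [Finset.disjoint_right.1 hAB hx'] at this
    have hsub : insert (A ∪ {a, b}) ((B.erase a).image fun x => A ∪ B.erase x) ⊆
        K.filter fun τ => insert a A ⊆ τ ∧ τ.card = 3 + 1 := by
      intro τ hτ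
      rw [Finset.mem_filter]
      rcases Finset.mem_insert.1 hτ with rfl | hτ
      · refine ⟨hl.2.2, by intro x; simp; tauto, ?_⟩
        rw [Finset.card_union_of_disjoint hl.2.1.symm, Finset.card_pair hab, hA]
      · obtain ⟨x, hx, rfl⟩ := Finset.mem_image.1 hτ
        rw [Finset.mem_erase] at hx
        refine ⟨hj x hx.2, ?_, ?_⟩
        · intro y hy
          rcases Finset.mem_insert.1 hy with rfl | hy
          · simp [ha, hx.1.symm]
          · simp [hy]
        · rw [Finset.card_union_of_disjoint (hAB.mono_right (Finset.erase_subset _ _)),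
            Finset.card_erase_of_mem hx.2, hA, hB]
    have := Finset.card_le_card hsub
    rw [Finset.card_insert_of_notMem, Finset.card_image_of_injOn hinj,
      Finset.card_erase_of_mem ha, hB, h2] at this
    · omega
    · intro hm
      obtain ⟨x, hx, he⟩ := Finset.mem_image.1 hm
      have : b ∈ A ∪ B.erase x := by rw [he]; simp
      simp [hbA, hb] at this
  have hconn := (hK.2.2 A hAK (by omega)).2
  obtain ⟨a, ha⟩ : B.Nonempty := Finset.card_pos.1 (by omega)
  obtain ⟨w, hw⟩ : (σ \ A).Nonempty := by
    rw [← Finset.card_pos, Finset.card_sdiff_of_subset hAσ]; omega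
  rw [Finset.mem_sdiff] at hw
  have haV : a ∈ verts (link K A) := by
    obtain ⟨x, hx⟩ : (B.erase a).Nonempty := by
      rw [← Finset.card_pos, Finset.card_erase_of_mem ha]; omega
    rw [Finset.mem_erase] at hx
    refine mem_verts.2 ⟨{a}, hC.mem_link.2 ⟨by simp, ?_, ?_⟩, by simp⟩
    · simpa using Finset.disjoint_right.1 hAB ha
    · refine hC.2.2 _ (hj x hx.2) _ ?_ (by simp)
      intro y hy
      rcases Finset.mem_union.1 hy with hy | hy
      · simp [hy]
      · rw [Finset.mem_singleton.1 hy]; simp [ha, hx.1.symm]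
  have hwV : w ∈ verts (link K A) := by
    refine mem_verts.2 ⟨{w}, hC.mem_link.2 ⟨by simp, by simpa using hw.2, ?_⟩, by simp⟩
    refine hC.2.2 _ hσ _ (Finset.union_subset hAσ (by simpa using hw.1)) (by simp)
  have hwB : w ∈ B := by
    have hp := hconn a haV w hwV
    clear hw hwV
    induction hp with
    | refl => exact ha
    | tail _ h ih => exact step _ ih _ h.1 h.2
  exact Finset.disjoint_left.1 hσB hw.1 hwB

end NPM

namespace NPM.Search

variable {α : Type*} [DecidableEq α]

theorem bits_two_pow {i : ℕ} (hi : i < 8) : bits (2 ^ i) = {i} := by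
  ext j
  rw [mem_bits, testBit_two_pow', Finset.mem_singleton]
  exact ⟨fun h => h.2, fun h => ⟨h ▸ hi, h⟩⟩

theorem bits_or (a b : ℕ) : bits (a ||| b) = bits a ∪ bits b := by
  ext j
  simp only [mem_bits, Nat.testBit_or, Bool.or_eq_true, Finset.mem_union]
  tauto

theorem bits_xor_two_pow {t i : ℕ} (hi : i ∈ bits t) : bits (t ^^^ 2 ^ i) = (bits t).erase i := by
  ext j
  rw [mem_bits] at hi
  rw [Finset.mem_erase, mem_bits, mem_bits, Nat.testBit_xor]
  by_cases h : j = i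
  · subst h
    simp [hi.2]
  · have : (2 ^ i).testBit j = false := by
      rw [← Bool.not_eq_true, testBit_two_pow']; exact h
    simp [this, h]

theorem bits_subset {k n : ℕ} (h : k &&& n = k) : bits k ⊆ bits n := by
  intro i hi
  rw [mem_bits] at hi ⊢
  rw [← h, Nat.testBit_and, Bool.and_eq_true] at hi
  exact ⟨hi.1, hi.2.2⟩

theorem lt_of_testBit {n : ℕ} (h : ∀ i, n.testBit i = true → i < 8) : n < 256 := by
  refine Nat.lt_pow_two_of_testBit (n := 8) n fun i hi => ?_
  by_contra hn
  have := h i (by simpa using hn)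
  omega

theorem lt_of_testBit_true {n i : ℕ} (hn : n < 256) (h : n.testBit i = true) : i < 8 := by
  by_contra hi
  rw [Nat.testBit_lt_two_pow (lt_of_lt_of_le hn
    (Nat.pow_le_pow_right (n := 2) (by norm_num) (show 8 ≤ i by omega)))] at h
  exact absurd h (by simp)

theorem and_eq_of_bits_subset {k n : ℕ} (hk : k < 256) (h : bits k ⊆ bits n) : k &&& n = k := by
  refine Nat.eq_of_testBit_eq fun i => ?_
  rw [Nat.testBit_and, Bool.eq_iff_iff, Bool.and_eq_true]
  exact ⟨fun h => h.1, fun hi =>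
    ⟨hi, (mem_bits.1 (h (mem_bits.2 ⟨lt_of_testBit_true hk hi, hi⟩))).2⟩⟩

theorem bits_injOn {a b : ℕ} (ha : a < 256) (hb : b < 256) (h : bits a = bits b) : a = b := by
  rw [← and_eq_of_bits_subset ha h.le, Nat.and_comm, and_eq_of_bits_subset hb h.ge]

theorem disjoint_bits {k t : ℕ} (h : k &&& t = 0) : Disjoint (bits k) (bits t) := by
  rw [Finset.disjoint_left]
  intro i hk ht
  rw [mem_bits] at hk ht
  have : (k &&& t).testBit i = true := by rw [Nat.testBit_and, hk.2, ht.2]; rfl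
  simp [h] at this

/-- The vertices of `K` are `e 0, …, e 7`. -/
structure Lab (K : Complex α) (e : ℕ → α) : Prop where
  inj : Set.InjOn e ↑(Finset.range 8)
  img : (Finset.range 8).image e = verts K

/-- The set of vertices coded by `n` in the labelling `e`. -/
def face (e : ℕ → α) (n : ℕ) : Finset α := (bits n).image e

/-- Whether the set coded by `n` is a face. -/
def pat (K : Complex α) (e : ℕ → α) (n : ℕ) : Bool := decide (face e n ∈ K)

theorem bits_subset_range (n : ℕ) : bits n ⊆ Finset.range 8 := Finset.filter_subset _ _

variable {K : Complex α} {e : ℕ → α}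

theorem Lab.injOn_bits (he : Lab K e) (n : ℕ) : Set.InjOn e ↑(bits n) :=
  he.inj.mono (Finset.coe_subset.2 (bits_subset_range n))

theorem Lab.card_face (he : Lab K e) (n : ℕ) : (face e n).card = (bits n).card :=
  Finset.card_image_of_injOn (he.injOn_bits n)

theorem Lab.mem_face (he : Lab K e) {n i : ℕ} (hi : i < 8) : e i ∈ face e n ↔ i ∈ bits n := by
  refine ⟨fun h => ?_, Finset.mem_image_of_mem e⟩
  obtain ⟨j, hj, hji⟩ := Finset.mem_image.1 h
  rwa [← he.inj (Finset.mem_coe.2 (bits_subset_range n hj)) (by simpa using hi) hji]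

theorem Lab.face_subset (he : Lab K e) {k n : ℕ} : face e k ⊆ face e n ↔ bits k ⊆ bits n := by
  refine ⟨fun h i hi => ?_, Finset.image_subset_image⟩
  exact (he.mem_face (by simpa using bits_subset_range k hi)).1 (h (Finset.mem_image_of_mem e hi))

theorem Lab.disjoint_face (he : Lab K e) {k n : ℕ} (h : Disjoint (bits k) (bits n)) :
    Disjoint (face e k) (face e n) := by
  rw [Finset.disjoint_left]
  intro x hk hn
  obtain ⟨i, hi, rfl⟩ := Finset.mem_image.1 hk
  exact Finset.disjoint_left.1 h hi
    ((he.mem_face (by simpa using bits_subset_range k hi)).1 hn)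

theorem Lab.face_inj (he : Lab K e) {k n : ℕ} (hk : k < 256) (hn : n < 256)
    (h : face e k = face e n) : k = n :=
  bits_injOn hk hn (Finset.Subset.antisymm (he.face_subset.1 h.le) (he.face_subset.1 h.ge))

theorem Lab.exists_face (he : Lab K e) {σ : Finset α} (h : σ ⊆ verts K) :
    ∃ n < 256, face e n = σ := by
  have hb : ∀ i, (maskOf ((Finset.range 8).filter fun i => e i ∈ σ).toList).testBit i = true ↔
      i < 8 ∧ e i ∈ σ := by
    intro i; rw [tb_maskOf]; simp
  refine ⟨_, lt_of_testBit fun i hi => ((hb i).1 hi).1, ?_⟩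
  ext x
  simp only [face, Finset.mem_image, mem_bits, hb]
  constructor
  · rintro ⟨i, ⟨-, -, hi⟩, rfl⟩; exact hi
  · intro hx
    have := h hx
    rw [← he.img, Finset.mem_image] at this
    obtain ⟨i, hi, rfl⟩ := this
    exact ⟨i, ⟨by simpa using hi, by simpa using hi, hx⟩, rfl⟩

theorem Lab.facets_eq_image (he : Lab K e) {k : ℕ} (hk : k < 256) :
    (K.filter fun τ => face e k ⊆ τ ∧ τ.card = 4) =
      ((star k).toFinset.filter fun n => pat K e n = true).image (face e) := by
  ext τ
  simp only [Finset.mem_filter, Finset.mem_image, List.mem_toFinset, mem_star, mem_tets, pat,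
    decide_eq_true_eq]
  constructor
  · rintro ⟨h, hs, hc⟩
    obtain ⟨n, hn, rfl⟩ := he.exists_face (subset_verts h)
    exact ⟨n, ⟨⟨⟨hn, by rw [← he.card_face, hc]⟩,
      and_eq_of_bits_subset hk (he.face_subset.1 hs)⟩, h⟩, rfl⟩
  · rintro ⟨n, ⟨⟨⟨hn, hc⟩, hs⟩, h⟩, rfl⟩
    exact ⟨h, he.face_subset.2 (bits_subset hs), by rw [he.card_face, hc]⟩

theorem Lab.card_star (he : Lab K e) {k : ℕ} (hk : k < 256) :
    ((star k).toFinset.filter fun n => pat K e n = true).card =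
      (K.filter fun τ => face e k ⊆ τ ∧ τ.card = 4).card := by
  rw [he.facets_eq_image hk, Finset.card_image_of_injOn]
  intro a ha b hb h
  simp only [Finset.mem_coe, Finset.mem_filter, List.mem_toFinset, mem_star, mem_tets] at ha hb
  exact he.face_inj ha.1.1.1 hb.1.1.1 h

theorem Lab.closed (he : Lab K e) (hK : WeakPM K 3) : Closed (pat K e) := by
  have h : ∀ x ∈ tets, ∀ i ∈ bits x, (ext (x ^^^ 2 ^ i)).toFinset = (star (x ^^^ 2 ^ i)).toFinset ∧
      x ^^^ 2 ^ i < 256 := by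
    decide +kernel
  intro x hx i hi
  obtain ⟨h1, h2⟩ := h x hx i hi
  have hc : (face e (x ^^^ 2 ^ i)).card = 3 := by
    rw [he.card_face, bits_xor_two_pow hi, Finset.card_erase_of_mem hi, (mem_tets.1 hx).2]
  rw [h1, he.card_star h2]
  by_cases hm : face e (x ^^^ 2 ^ i) ∈ K
  · exact .inr (hK.2.2 _ hm hc)
  · left
    rw [Finset.card_eq_zero, Finset.filter_eq_empty_iff]
    rintro τ hτ ⟨hs, -⟩
    exact hm (hK.1.2.2 τ hτ _ hs (Finset.card_pos.1 (by omega)))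

theorem not_split {k t n : ℕ} (hK : NormalPM K 3) (he : Lab K e) (hk : (bits k).card = 2)
    (ht : (bits t).card = 3) (hkt : k &&& t = 0) (hj : ∀ m ∈ joins k t, face e m ∈ K)
    (hn : n ∈ star k) (hnK : face e n ∈ K) (hnt : n &&& t = 0) : False := by
  have hn' := mem_star.1 hn
  refine hK.not_disjoint_triangle (A := face e k) (B := face e t) (σ := face e n)
    (by rw [he.card_face, hk]) (by rw [he.card_face, ht]) (he.disjoint_face (disjoint_bits hkt))
    ?_ hnK (he.face_subset.2 (bits_subset hn'.2)) (by rw [he.card_face, (mem_tets.1 hn'.1).2])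
    (he.disjoint_face (disjoint_bits hnt))
  intro x hx
  obtain ⟨i, hi, rfl⟩ := Finset.mem_image.1 hx
  have := hj (k ||| (t ^^^ 2 ^ i)) (by
    rw [joins, List.mem_map]
    refine ⟨i, ?_, rfl⟩
    rw [mem_bits] at hi
    simp [tb_eq, hi])
  rw [face, bits_or, bits_xor_two_pow hi, Finset.image_union] at this
  have hB : (face e t).erase (e i) = ((bits t).erase i).image e := by
    ext y
    simp only [face, Finset.mem_erase, Finset.mem_image]
    constructor
    · rintro ⟨hne, j, hj, rfl⟩
      exact ⟨j, ⟨fun h => hne (h ▸ rfl), hj⟩, rfl⟩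
    · rintro ⟨j, ⟨hne, hj⟩, rfl⟩
      exact ⟨fun h => hne (he.injOn_bits t hj hi h), j, hj, rfl⟩
  rw [hB]
  exact this

theorem bijOn_getD {ps : List ℕ} (h : ∀ i < 8, i ∈ ps) (hl : ps.length = 8) :
    (Finset.range 8).image (fun i => ps.getD i 0) = Finset.range 8 := by
  symm
  refine Finset.eq_of_subset_of_card_le ?_ Finset.card_image_le
  intro j hj
  obtain ⟨i, hi, rfl⟩ := List.mem_iff_getElem.1 (h j (by simpa using hj))
  exact Finset.mem_image.2 ⟨i, by simpa [hl] using hi, by simp [hi]⟩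

theorem bits_ap {ps : List ℕ} (h : ∀ i < 8, i ∈ ps) (hl : ps.length = 8) (n : ℕ) :
    bits (ap ps n) = (bits n).image fun i => ps.getD i 0 := by
  ext j
  simp only [mem_bits, testBit_ap, Finset.mem_image]
  constructor
  · rintro ⟨-, i, hi, hn, rfl⟩
    exact ⟨i, ⟨hl ▸ hi, hn⟩, by simp [hi]⟩
  · rintro ⟨i, ⟨hi, hn⟩, rfl⟩
    have : ps.getD i 0 ∈ Finset.range 8 := by
      rw [← bijOn_getD h hl]
      exact Finset.mem_image.2 ⟨i, by simpa using hi, rfl⟩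
    exact ⟨by simpa using this, i, hl ▸ hi, hn, by simp [hl, hi]⟩

theorem ap_mem_tets {ps : List ℕ} (h : ∀ i < 8, i ∈ ps) (hl : ps.length = 8) {n : ℕ}
    (hn : n ∈ tets) : ap ps n ∈ tets := by
  have hb := bijOn_getD h hl
  rw [mem_tets] at hn ⊢
  constructor
  · refine lt_of_testBit fun j hj => ?_
    obtain ⟨i, hi, -, rfl⟩ := (testBit_ap ps n j).1 hj
    have : ps.getD i 0 ∈ Finset.range 8 := by
      rw [← hb]
      exact Finset.mem_image.2 ⟨i, by simpa [hl] using hi, rfl⟩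
    simpa [hi] using this
  · rw [bits_ap h hl, Finset.card_image_of_injOn, hn.2]
    exact (Finset.injOn_of_card_image_eq (by rw [hb])).mono
      (Finset.coe_subset.2 (bits_subset_range n))

theorem Lab.comp (he : Lab K e) {ps : List ℕ} (h : ∀ i < 8, i ∈ ps) (hl : ps.length = 8) :
    Lab K fun i => e (ps.getD i 0) := by
  have hb := bijOn_getD h hl
  have hinj : Set.InjOn (fun i => ps.getD i 0) ↑(Finset.range 8) :=
    Finset.injOn_of_card_image_eq (by rw [hb])
  refine ⟨he.inj.comp hinj fun i hi => ?_, ?_⟩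
  · rw [Finset.mem_coe, ← hb]
    exact Finset.mem_image_of_mem _ hi
  · rw [← he.img]
    conv_rhs => rw [← hb]
    rw [Finset.image_image]
    rfl

theorem face_comp {ps : List ℕ} (h : ∀ i < 8, i ∈ ps) (hl : ps.length = 8) (n : ℕ) :
    face (fun i => e (ps.getD i 0)) n = face e (ap ps n) := by
  rw [face, face, bits_ap h hl, Finset.image_image]
  rfl

/-- Soundness of the search. -/
theorem exists_lab {k₀ k₁ : ℕ} {order : List ℕ} {s₀ : ℕ} {forb : List (ℕ × ℕ)}
    {targets : List ℕ} {fix : Bool} {certs : List Cert}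
    (hs : searchOK k₀ k₁ order s₀ forb targets fix certs = true) (hK : NormalPM K 3)
    (he : Lab K e) (h₀ : ∀ n ∈ star k₁, pat K e n = s₀.testBit n)
    (hf : ∀ p ∈ forb, p.2 < 36 ∧
      ((star p.1).toFinset.filter fun n => pat K e n = true).card ≠ p.2) :
    ∃ e', ∃ C ∈ targets, Lab K e' ∧ (fix = true → e' 7 = e 7) ∧
      ∀ n ∈ star k₀, pat K e' n = C.testBit n := by
  simp only [searchOK, Bool.and_eq_true, List.all_eq_true, List.contains_iff_mem, Bool.or_eq_true,
    Bool.not_eq_true', beq_iff_eq, List.mem_range, tb_eq, Nat.blt_eq] at hs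
  obtain ⟨⟨⟨⟨⟨ho, hk⟩, hforb⟩, hs₀⟩, hlt⟩, hc⟩ := hs
  have hD : ∀ n, s₀.testBit n = true → (maskOf (star k₁)).testBit n = true := by
    intro n hn
    rw [tb_maskOf]
    have hn' : n < 256 := by
      by_contra h
      rw [Nat.testBit_lt_two_pow (lt_of_lt_of_le hlt
        (Nat.pow_le_pow_right (n := 2) (by norm_num) (show 256 ≤ n by omega)))] at hn
      exact absurd hn (by simp)
    exact (hs₀ n hn').resolve_left (by simp [hn])
  obtain ⟨s, hs, hsP⟩ := exists_mem_enum (he.closed hK.1) order _ s₀ ho hD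
    fun n hn => h₀ n ((tb_maskOf _ n).1 hn)
  have hP : ∀ n ∈ star k₀, pat K e n = s.testBit n := fun n hn =>
    hsP n (by rw [tb_maskOf]; exact hk n hn)
  have hadm : admissible forb s = true := by
    rw [admissible, List.all_eq_true]
    intro p hp
    have h := hforb p hp
    have hpop := pop_eq 36 (Nat.land s (maskOf (star p.1)))
      ((star p.1).toFinset.filter fun n => pat K e n = true) fun j => by
        rw [nat_and, Nat.testBit_and, Bool.and_eq_true, tb_maskOf, Finset.mem_filter,
          List.mem_toFinset, and_comm]
        exact and_congr_right fun hj => by rw [hP j (star_subset h hj)]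
    have := hf p hp
    rw [hpop, Bool.not_eq_true', ← Bool.not_eq_true, Nat.beq_eq]
    omega
  obtain ⟨c, hc⟩ := exists_certOK hc s (List.mem_filter.2 ⟨hs, hadm⟩)
  cases c with
  | split k t n =>
    simp only [certOK, Bool.and_eq_true, List.all_eq_true, List.contains_iff_mem, beq_iff_eq,
      tb_eq, nat_and] at hc
    obtain ⟨⟨⟨⟨⟨⟨⟨hk, ht⟩, hkt⟩, hj⟩, hn₀⟩, hn⟩, hns⟩, hnt⟩ := hc
    have hmem : ∀ m ∈ star k₀, s.testBit m = true → face e m ∈ K := fun m hm h => by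
      rw [← hP m hm] at h
      exact of_decide_eq_true h
    exact (not_split hK he hk ht hkt (fun m hm => hmem m (hj m hm).1 (hj m hm).2) hn
      (hmem n hn₀ hns) hnt).elim
  | iso ps j =>
    rw [certOK] at hc
    cases hC : targets[j]? with
    | none => simp [hC] at hc
    | some C =>
      simp only [hC, Bool.and_eq_true, List.all_eq_true, List.contains_iff_mem, beq_iff_eq,
        tb_eq, nat_and, List.mem_range, Bool.or_eq_true, Bool.not_eq_true'] at hc
      obtain ⟨⟨⟨hp, hl⟩, hfix⟩, hm⟩ := hc
      refine ⟨fun i => e (ps.getD i 0), C, List.mem_of_getElem? hC, he.comp hp hl, fun h => ?_,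
        fun n hn => ?_⟩
      · exact congrArg e (hfix.resolve_left (by simp [h]))
      · have h := hm n hn
        rw [← h.2, ← hP _ (mem_star.2 ⟨ap_mem_tets hp hl (mem_star.1 hn).1, h.1⟩), pat, pat,
          face_comp hp hl]

end NPM.Search

namespace NPM

variable {α : Type*} [DecidableEq α]

theorem insert_mem_of_mem_link {K : Complex α} {v : α} {σ : Finset α} (h : σ ∈ link K {v}) :
    v ∉ σ ∧ insert v σ ∈ K := by
  rw [mem_link, Finset.disjoint_singleton_right] at h
  exact h.2

theorem IsComplex.erase_mem_link {K : Complex α} (hK : IsComplex K) {v : α} {τ : Finset α}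
    (h : τ ∈ K) (hv : v ∈ τ) (hτ : 2 ≤ τ.card) : τ.erase v ∈ link K {v} := by
  refine hK.mem_link.2 ⟨?_, ?_, ?_⟩
  · rw [← Finset.card_pos, Finset.card_erase_of_mem hv]; omega
  · simp
  · rwa [← Finset.insert_eq, Finset.insert_erase hv]

theorem IsComplex.card_filter_link {K : Complex α} (hK : IsComplex K) {v : α} {σ : Finset α}
    {d : ℕ} (hd : 1 ≤ d) :
    ((link K {v}).filter fun τ => σ ⊆ τ ∧ τ.card = d).card =
      (K.filter fun τ => insert v σ ⊆ τ ∧ τ.card = d + 1 ∧ v ∉ σ).card := by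
  refine Finset.card_nbij' (insert v) (Finset.erase · v) ?_ ?_ ?_ ?_
  · intro τ hτ
    simp only [Finset.mem_coe, Finset.mem_filter] at hτ ⊢
    obtain ⟨hv, hm⟩ := insert_mem_of_mem_link hτ.1
    exact ⟨hm, Finset.insert_subset_insert v hτ.2.1, by
      rw [Finset.card_insert_of_notMem hv, hτ.2.2], fun h => hv (hτ.2.1 h)⟩
  · intro τ hτ
    simp only [Finset.mem_coe, Finset.mem_filter] at hτ ⊢
    have hv : v ∈ τ := hτ.2.1 (by simp)
    refine ⟨hK.erase_mem_link hτ.1 hv (by omega), ?_, by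
      rw [Finset.card_erase_of_mem hv]; omega⟩
    rw [Finset.subset_erase]
    exact ⟨(Finset.subset_insert v σ).trans hτ.2.1, hτ.2.2.2⟩
  · intro τ hτ
    simp only [Finset.mem_coe, Finset.mem_filter] at hτ
    exact Finset.erase_insert (insert_mem_of_mem_link hτ.1).1
  · intro τ hτ
    simp only [Finset.mem_coe, Finset.mem_filter] at hτ
    exact Finset.insert_erase (hτ.2.1 (by simp))

theorem IsComplex.isComplex_link {K : Complex α} (hK : IsComplex K) {v w : α}
    (h : {v, w} ∈ K) (hvw : v ≠ w) : IsComplex (link K {v}) := by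
  refine ⟨⟨_, hK.erase_mem_link h (by simp) (by rw [Finset.card_pair hvw])⟩,
    fun σ hσ => (hK.mem_link.1 hσ).1, fun σ hσ τ hτ hne => ?_⟩
  rw [hK.mem_link] at hσ ⊢
  exact ⟨hne, hσ.2.1.mono_left hτ, hK.2.2 _ hσ.2.2 _ (Finset.union_subset_union_right hτ)
    (by simp)⟩

theorem link_link {K : Complex α} (hK : IsComplex K) {v : α} {σ : Finset α}
    (hσ : v ∉ σ) : link (link K {v}) σ = link K (insert v σ) := by
  ext τ
  rw [mem_link, hK.mem_link, hK.mem_link, hK.mem_link]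
  simp only [Finset.disjoint_insert_right, Finset.disjoint_singleton_right, Finset.mem_union,
    ← Finset.insert_eq, Finset.insert_union]
  constructor
  · rintro ⟨⟨h1, h2, -⟩, h3, -, -, h4⟩
    exact ⟨h1, ⟨h2, h3⟩, h4⟩
  · rintro ⟨h1, ⟨h2, h3⟩, h4⟩
    exact ⟨⟨h1, h2, hK.2.2 _ h4 _ (Finset.insert_subset_insert v Finset.subset_union_right)
      (by simp)⟩, h3, h1.mono Finset.subset_union_right, by tauto, h4⟩

theorem WeakPM.link {K : Complex α} {d : ℕ} (hK : WeakPM K (d + 1)) (hd : 1 ≤ d) {v : α}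
    (hv : {v} ∈ K) : WeakPM (link K {v}) d := by
  obtain ⟨hC, hP, hF⟩ := hK
  refine ⟨?_, ?_, ?_⟩
  · obtain ⟨τ, hτ, hs, hc⟩ := hP _ hv
    rw [Finset.singleton_subset_iff] at hs
    obtain ⟨w, hw⟩ : (τ.erase v).Nonempty := by
      rw [← Finset.card_pos, Finset.card_erase_of_mem hs]; omega
    rw [Finset.mem_erase] at hw
    exact hC.isComplex_link (hC.2.2 τ hτ {v, w}
      (by simp [Finset.insert_subset_iff, hs, hw.2]) (by simp)) hw.1.symm
  · intro σ hσ
    obtain ⟨hvσ, hm⟩ := insert_mem_of_mem_link hσ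
    obtain ⟨τ, hτ, hs, hc⟩ := hP _ hm
    have hvτ : v ∈ τ := hs (by simp)
    refine ⟨_, hC.erase_mem_link hτ hvτ (by omega), ?_, by
      rw [Finset.card_erase_of_mem hvτ]; omega⟩
    rw [Finset.subset_erase]
    exact ⟨(Finset.subset_insert v σ).trans hs, hvσ⟩
  · intro σ hσ hc
    obtain ⟨hvσ, hm⟩ := insert_mem_of_mem_link hσ
    rw [hC.card_filter_link (by omega), ← hF _ hm (by rw [Finset.card_insert_of_notMem hvσ, hc])]
    simp [hvσ]

theorem NormalPM.link {K : Complex α} {d : ℕ} (hK : NormalPM K (d + 1)) (hd : 1 ≤ d) {v : α}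
    (hv : {v} ∈ K) : NormalPM (link K {v}) d := by
  refine ⟨hK.1.link hd hv, hK.2.2 _ hv (by simpa using hd), fun σ hσ hc => ?_⟩
  obtain ⟨hvσ, hm⟩ := insert_mem_of_mem_link hσ
  rw [link_link hK.1.1 hvσ]
  exact hK.2.2 _ hm (by rw [Finset.card_insert_of_notMem hvσ]; omega)

/-- A connected weak pseudomanifold is strongly connected if this holds locally. -/
theorem WeakPM.sConn {K : Complex α} {d : ℕ} (hK : WeakPM K d) (hC : Conn K)
    (h : ∀ v, ∀ σ ∈ facets K d, ∀ τ ∈ facets K d, v ∈ σ → v ∈ τ → Relation.ReflTransGen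
      (fun a b => a ∈ facets K d ∧ b ∈ facets K d ∧ (a ∩ b).card = d) σ τ) : SConn K d := by
  intro σ hσ τ hτ
  have hσ' := Finset.mem_filter.1 hσ
  have hτ' := Finset.mem_filter.1 hτ
  obtain ⟨u, hu⟩ := hK.1.2.1 _ hσ'.1
  obtain ⟨w, hw⟩ := hK.1.2.1 _ hτ'.1
  have hp := hC.2 u (mem_verts.2 ⟨σ, hσ'.1, hu⟩) w (mem_verts.2 ⟨τ, hτ'.1, hw⟩)
  clear hτ'
  induction hp generalizing τ with
  | refl => exact h u σ hσ τ hτ hu hw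
  | @tail b c _ hbc ih =>
    obtain ⟨ρ, hρ, hs, hc⟩ := hK.2.1 _ hbc.2
    have hρ' : ρ ∈ facets K d := Finset.mem_filter.2 ⟨hρ, hc⟩
    exact (ih ρ hρ' (hs (by simp))).trans (h c ρ hρ' τ hτ (hs (by simp)) hw)

theorem NormalPM.sConn {d : ℕ} : ∀ {K : Complex α}, NormalPM K (d + 1) → SConn K (d + 1) := by
  induction d with
  | zero =>
    intro K hK
    refine hK.1.sConn hK.2.1 fun v σ hσ τ hτ hvσ hvτ => ?_
    by_cases h : σ = τ
    · rw [h]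
    · refine .single ⟨hσ, hτ, ?_⟩
      rw [facets, Finset.mem_filter] at hσ hτ
      have hpos : 0 < (σ ∩ τ).card := Finset.card_pos.2 ⟨v, by simp [hvσ, hvτ]⟩
      have hlt : (σ ∩ τ).card < σ.card := by
        refine Finset.card_lt_card (Finset.ssubset_iff_subset_ne.2
          ⟨Finset.inter_subset_left, fun he => h ?_⟩)
        exact Finset.eq_of_subset_of_card_le (Finset.inter_eq_left.1 he) (by omega)
      omega
  | succ d ih =>
    intro K hK
    refine hK.1.sConn hK.2.1 fun v σ hσ τ hτ hvσ hvτ => ?_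
    have hC := hK.1.1
    have hv : {v} ∈ K := hC.singleton_mem.2 (mem_verts.2 ⟨σ, (Finset.mem_filter.1 hσ).1, hvσ⟩)
    have hmem : ∀ ρ ∈ facets K (d + 1 + 1), v ∈ ρ →
        ρ.erase v ∈ facets (NPM.link K {v}) (d + 1) := by
      intro ρ hρ hvρ
      rw [facets, Finset.mem_filter] at hρ ⊢
      exact ⟨hC.erase_mem_link hρ.1 hvρ (by omega), by rw [Finset.card_erase_of_mem hvρ]; omega⟩
    have := (ih (hK.link (by omega) hv) _ (hmem σ hσ hvσ) _ (hmem τ hτ hvτ)).lift (insert v)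
      (p := fun a b => a ∈ facets K (d + 1 + 1) ∧ b ∈ facets K (d + 1 + 1) ∧
        (a ∩ b).card = d + 1 + 1) fun a b hab => by
      simp only [facets, Finset.mem_filter] at hab ⊢
      have ha := insert_mem_of_mem_link hab.1.1
      have hb := insert_mem_of_mem_link hab.2.1.1
      refine ⟨⟨ha.2, by rw [Finset.card_insert_of_notMem ha.1, hab.1.2]⟩,
        ⟨hb.2, by rw [Finset.card_insert_of_notMem hb.1, hab.2.1.2]⟩, ?_⟩
      rw [← Finset.insert_inter_distrib, Finset.card_insert_of_notMem (by simp [ha.1]), hab.2.2]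
    rwa [Function.onFun, Finset.insert_erase hvσ, Finset.insert_erase hvτ] at this

/-- The number of 3-dimensional facets containing `σ`. -/
def facetDegree (K : Complex α) (σ : Finset α) : ℕ :=
  (K.filter fun τ => σ ⊆ τ ∧ τ.card = 4).card

theorem WeakPM.two_mul_card_edges {L : Complex α} (hL : WeakPM L 2) :
    2 * (L.filter fun σ => σ.card = 2).card = 3 * (L.filter fun σ => σ.card = 3).card := by
  rw [mul_comm, mul_comm 3]
  refine Finset.card_mul_eq_card_mul (fun σ τ : Finset α => σ ⊆ τ) (fun σ hσ => ?_) fun τ hτ => ?_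
  · rw [Finset.mem_filter] at hσ
    rw [← hL.2.2 σ hσ.1 hσ.2, Finset.bipartiteAbove, Finset.filter_filter]
    congr 1
    ext τ
    simp only [Finset.mem_filter]
    tauto
  · rw [Finset.mem_filter] at hτ
    have : Finset.bipartiteBelow (fun σ τ : Finset α => σ ⊆ τ)
        (L.filter fun σ => σ.card = 2) τ = τ.powersetCard 2 := by
      ext σ
      simp only [Finset.bipartiteBelow, Finset.mem_filter, Finset.mem_powersetCard]
      exact ⟨fun h => ⟨h.2, h.1.2⟩, fun h => ⟨⟨hL.1.2.2 τ hτ.1 σ h.1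
        (Finset.card_pos.1 (by omega)), h.2⟩, h.1⟩⟩
    rw [this, Finset.card_powersetCard, hτ.2]
    rfl

theorem IsComplex.card_vertices {L : Complex α} (hL : IsComplex L) :
    (L.filter fun σ => σ.card = 1).card = (verts L).card := by
  rw [← Finset.card_image_of_injective (verts L) Finset.singleton_injective]
  congr 1
  ext σ
  simp only [Finset.mem_filter, Finset.mem_image, Finset.card_eq_one]
  constructor
  · rintro ⟨h, v, rfl⟩
    exact ⟨v, hL.singleton_mem.1 h, rfl⟩
  · rintro ⟨v, h, rfl⟩
    exact ⟨hL.singleton_mem.2 h, v, rfl⟩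

theorem Neighbourly.verts_link {K : Complex α} (hN : Neighbourly K) (hC : IsComplex K) {v : α}
    (hv : v ∈ verts K) : verts (link K {v}) = (verts K).erase v := by
  ext w
  rw [Finset.mem_erase, mem_verts]
  constructor
  · rintro ⟨σ, hσ, hw⟩
    obtain ⟨hvσ, hm⟩ := insert_mem_of_mem_link hσ
    exact ⟨fun h => hvσ (h ▸ hw), mem_verts.2 ⟨_, hm, Finset.mem_insert_of_mem hw⟩⟩
  · rintro ⟨hne, hw⟩
    exact ⟨_, hC.erase_mem_link (hN v hv w hw hne.symm) (by simp)
      (by rw [Finset.card_pair hne.symm]), by simp [hne]⟩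

theorem IsComplex.card_facets_link {K : Complex α} (hC : IsComplex K) (v : α) :
    ((link K {v}).filter fun σ => σ.card = 3).card = facetDegree K {v} := by
  simpa [facetDegree] using hC.card_filter_link (v := v) (σ := ∅) (d := 3) (by omega)

variable {K : Complex α}

theorem NormalPM.even_facetDegree (hK : NormalPM K 3) {v : α} (hv : v ∈ verts K) :
    Even (facetDegree K {v}) := by
  have := (hK.1.link (by omega) (hK.1.1.singleton_mem.2 hv)).two_mul_card_edges
  rw [hK.1.1.card_facets_link] at this
  rw [even_iff_two_dvd]
  omega

theorem NormalPM.comb2Sphere_link (hK : NormalPM K 3) (hN : Neighbourly K)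
    (h8 : (verts K).card = 8) {v : α} (hv : {v} ∈ K) (ht : facetDegree K {v} = 10) :
    Comb2Sphere (NPM.link K {v}) := by
  have hL := hK.link (by omega) hv
  refine ⟨⟨hL.1, fun w hw => ?_⟩, hL.2.1, ?_⟩
  · have := hL.link le_rfl hw
    exact ⟨this.1, this.sConn⟩
  · have hv' := hK.1.1.singleton_mem.1 hv
    have h1 := hL.1.two_mul_card_edges
    have h0 := hL.1.1.card_vertices
    rw [hK.1.1.card_facets_link, ht] at h1
    rw [hN.verts_link hK.1.1 hv', Finset.card_erase_of_mem hv', h8] at h0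
    rw [eulerChar, hK.1.1.card_facets_link, ht, h0]
    omega

/-- Every facet at `v` has three further vertices. -/
theorem sum_facetDegree {v : α} :
    ∑ w ∈ (verts K).erase v, facetDegree K {v, w} = 3 * facetDegree K {v} := by
  have h := Finset.sum_card_bipartiteAbove_eq_sum_card_bipartiteBelow
    (s := (verts K).erase v) (t := K.filter fun τ => {v} ⊆ τ ∧ τ.card = 4)
    fun (w : α) τ => w ∈ τ
  have h1 : ∀ w, (Finset.bipartiteAbove (fun (w : α) τ => w ∈ τ)
      (K.filter fun τ => {v} ⊆ τ ∧ τ.card = 4) w).card = facetDegree K {v, w} := by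
    intro w
    rw [facetDegree, Finset.bipartiteAbove, Finset.filter_filter]
    congr 1
    ext τ
    simp only [Finset.mem_filter, Finset.insert_subset_iff, Finset.singleton_subset_iff]
    tauto
  have h2 : ∀ τ ∈ K.filter fun τ => {v} ⊆ τ ∧ τ.card = 4,
      (Finset.bipartiteBelow (fun (w : α) τ => w ∈ τ) ((verts K).erase v) τ).card = 3 := by
    intro τ hτ
    rw [Finset.mem_filter, Finset.singleton_subset_iff] at hτ
    have : Finset.bipartiteBelow (fun (w : α) τ => w ∈ τ) ((verts K).erase v) τ = τ.erase v := by
      ext w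
      simp only [Finset.bipartiteBelow, Finset.mem_filter, Finset.mem_erase]
      exact ⟨fun h => ⟨h.1.1, h.2⟩, fun h => ⟨⟨h.1, subset_verts hτ.1 h.2⟩, h.2⟩⟩
    rw [this, Finset.card_erase_of_mem hτ.2.1, hτ.2.2]
  rw [Finset.sum_congr rfl fun w _ => h1 w, Finset.sum_congr rfl h2, Finset.sum_const,
    smul_eq_mul, mul_comm] at h
  exact h

theorem Neighbourly.facetDegree_ne_zero (hN : Neighbourly K) (hK : WeakPM K 3) {v w : α}
    (hv : v ∈ verts K) (hw : w ∈ verts K) (hvw : v ≠ w) : facetDegree K {v, w} ≠ 0 := by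
  obtain ⟨τ, hτ, hs, hc⟩ := hK.2.1 _ (hN v hv w hw hvw)
  exact Finset.card_ne_zero_of_mem (Finset.mem_filter.2 ⟨hτ, hs, hc⟩)

end NPM

namespace NPM

variable {α : Type*} [DecidableEq α]

theorem mem_genCx {F : Finset (Finset α)} {σ : Finset α} :
    σ ∈ genCx F ↔ σ.Nonempty ∧ ∃ τ ∈ F, σ ⊆ τ := by
  simp only [genCx, Finset.mem_biUnion, Finset.mem_filter, Finset.mem_powerset]
  constructor
  · rintro ⟨τ, hτ, hs, hne⟩
    exact ⟨hne, τ, hτ, hs⟩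
  · rintro ⟨hne, τ, hτ, hs⟩
    exact ⟨τ, hτ, hs, hne⟩

/-- The facets after a bistellar move on `A`. -/
def moveFacets (F : Finset (Finset α)) (A : Finset α) : Finset (Finset α) :=
  F.filter (fun σ => ¬ A ⊆ σ) ∪
    A.image fun v => (((F.filter fun σ => A ⊆ σ).biUnion fun σ => σ \ A) ∪ A).erase v

theorem kappa_genCx {F : Finset (Finset α)} {A : Finset α} (hF : ∀ σ ∈ F, σ.card = 4) :
    kappa 3 (genCx F) A = genCx (moveFacets F A) := by
  have h1 : facets (genCx F) 3 = F := by
    ext σ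
    rw [facets, Finset.mem_filter, mem_genCx]
    constructor
    · rintro ⟨⟨-, τ, hτ, hs⟩, hc⟩
      rwa [Finset.eq_of_subset_of_card_le hs (by rw [hF τ hτ, hc])]
    · intro h
      exact ⟨⟨Finset.card_pos.1 (by rw [hF σ h]; omega), σ, h, subset_rfl⟩, hF σ h⟩
  have h2 : verts (link (genCx F) A) = (F.filter fun σ => A ⊆ σ).biUnion fun σ => σ \ A := by
    ext x
    simp only [mem_verts, mem_link, mem_genCx, Finset.mem_biUnion, Finset.mem_filter,
      Finset.mem_sdiff]
    constructor
    · rintro ⟨σ, ⟨-, hd, -, τ, hτ, hs⟩, hx⟩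
      exact ⟨τ, ⟨hτ, Finset.subset_union_left.trans hs⟩, hs (by simp [hx]),
        Finset.disjoint_left.1 hd hx⟩
    · rintro ⟨τ, ⟨hτ, hs⟩, hx, hxA⟩
      exact ⟨{x}, ⟨⟨by simp, τ, hτ, by simpa using hx⟩, by simpa using hxA, by simp, τ, hτ,
        Finset.union_subset hs (by simpa using hx)⟩, by simp⟩
  rw [kappa, h1, h2, moveFacets]

end NPM

namespace NPM.Search

variable {α : Type*} [DecidableEq α]

/-- The sets coded by the elements of `S`, with vertices renamed from `0, …, 7` to `1, …, 8`. -/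
def decode (S : Finset ℕ) : Finset (Finset ℕ) :=
  S.image fun n => (bits n).image fun i => i + 1

/-- The complex on `1, …, 8` whose facets are coded by `s`. -/
def model (s : ℕ) : Complex ℕ := genCx (decode (tets.filter (tb s)).toFinset)

theorem iso_genCx {L : Complex α} {d : ℕ} (hL : IsComplex L) (hp : IsPure L d) {e : ℕ → α}
    (he : Set.InjOn e ↑(Finset.range 8)) {S : Finset ℕ} (hS : facets L d = S.image (face e)) :
    Iso L (genCx (decode S)) := by
  set g : α → ℕ := Function.invFunOn e ↑(Finset.range 8) with hg
  have hge : ∀ i < 8, g (e i) = i := fun i hi =>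
    he.leftInvOn_invFunOn (by simpa using hi)
  have hface : ∀ n, (face e n).image (fun a => g a + 1) = (bits n).image fun i => i + 1 := by
    intro n
    rw [face, Finset.image_image]
    exact Finset.image_congr fun i hi => by simp [hge i (mem_bits.1 hi).1]
  have hpS : ∀ σ ∈ L, ∃ n ∈ S, σ ⊆ face e n ∧ face e n ∈ L := by
    intro σ hσ
    obtain ⟨τ, hτ, hs, hc⟩ := hp σ hσ
    have : τ ∈ facets L d := Finset.mem_filter.2 ⟨hτ, hc⟩
    rw [hS, Finset.mem_image] at this
    obtain ⟨n, hn, rfl⟩ := this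
    exact ⟨n, hn, hs, hτ⟩
  refine ⟨fun a => g a + 1, ?_, ?_⟩
  · have hv : ∀ a ∈ verts L, ∃ i < 8, e i = a := by
      intro a ha
      obtain ⟨σ, hσ, haσ⟩ := mem_verts.1 ha
      obtain ⟨n, -, hs, -⟩ := hpS σ hσ
      obtain ⟨i, hi, rfl⟩ := Finset.mem_image.1 (hs haσ)
      exact ⟨i, (mem_bits.1 hi).1, rfl⟩
    intro a ha b hb hab
    obtain ⟨i, hi, rfl⟩ := hv a ha
    obtain ⟨j, hj, rfl⟩ := hv b hb
    simp only [hge i hi, hge j hj, Nat.add_right_cancel_iff] at hab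
    rw [hab]
  · ext τ
    simp only [mem_genCx, decode, Finset.mem_image, exists_exists_and_eq_and]
    constructor
    · rintro ⟨hne, n, hn, hs⟩
      rw [← hface, Finset.subset_image_iff] at hs
      obtain ⟨σ, hσ, rfl⟩ := hs
      have hm : face e n ∈ facets L d := hS ▸ Finset.mem_image_of_mem _ hn
      exact ⟨σ, hL.2.2 _ (Finset.mem_filter.1 hm).1 σ (by simpa using hσ)
        (Finset.image_nonempty.1 hne), rfl⟩
    · rintro ⟨σ, hσ, rfl⟩
      obtain ⟨n, hn, hs, -⟩ := hpS σ hσ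
      exact ⟨(hL.2.1 σ hσ).image _, n, hn, by
        rw [← hface]; exact Finset.image_subset_image hs⟩

theorem N5_eq : N5 = model (finals.getD 0 0) := congrArg genCx (by decide +kernel)

theorem N6_eq : N6 = model (finals.getD 1 0) := congrArg genCx (by decide +kernel)

theorem N7_eq : N7 = model (finals.getD 2 0) := congrArg genCx (by decide +kernel)

theorem N8_eq : N8 = model (finals.getD 3 0) := by
  rw [N8, N7_eq, model, kappa_genCx (by decide +kernel), kappa_genCx (by decide +kernel),
    kappa_genCx (by decide +kernel), kappa_genCx (by decide +kernel)]
  exact congrArg genCx (by decide +kernel)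

theorem N9_eq : N9 = model (finals.getD 4 0) := by
  rw [N9, N7_eq, model, kappa_genCx (by decide +kernel), kappa_genCx (by decide +kernel)]
  exact congrArg genCx (by decide +kernel)

theorem N10_eq : N10 = model (finals.getD 5 0) := by
  rw [N10, N7_eq, model, kappa_genCx (by decide +kernel), kappa_genCx (by decide +kernel)]
  exact congrArg genCx (by decide +kernel)

theorem N11_eq : N11 = model (finals.getD 6 0) := by
  rw [N11, N10_eq, model, kappa_genCx (by decide +kernel), kappa_genCx (by decide +kernel)]
  exact congrArg genCx (by decide +kernel)

theorem N12_eq : N12 = model (finals.getD 7 0) := by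
  rw [N12, N9_eq, model, kappa_genCx (by decide +kernel), kappa_genCx (by decide +kernel)]
  exact congrArg genCx (by decide +kernel)

theorem N13_eq : N13 = model (finals.getD 8 0) := by
  rw [N13, N9_eq, model, kappa_genCx (by decide +kernel), kappa_genCx (by decide +kernel)]
  exact congrArg genCx (by decide +kernel)

theorem N14_eq : N14 = model (finals.getD 9 0) := by
  rw [N14, N8_eq, model, kappa_genCx (by decide +kernel), kappa_genCx (by decide +kernel)]
  exact congrArg genCx (by decide +kernel)

theorem N15_eq : N15 = model (finals.getD 10 0) := by
  rw [N15, N9_eq, model, kappa_genCx (by decide +kernel), kappa_genCx (by decide +kernel)]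
  exact congrArg genCx (by decide +kernel)

theorem map_model_finals :
    finals.map model = [N5, N6, N7, N8, N9, N10, N11, N12, N13, N14, N15] := by
  rw [N5_eq, N6_eq, N7_eq, N8_eq, N9_eq, N10_eq, N11_eq, N12_eq, N13_eq, N14_eq, N15_eq]
  rfl

theorem T7_eq : T7 =
    genCx (decode (((star 128).filter (tb torus)).toFinset.image fun n => n ^^^ 2 ^ 7)) :=
  congrArg genCx (by decide +kernel)

end NPM.Search

namespace NPM.Search

variable {α : Type*} [DecidableEq α] {K : Complex α} {e : ℕ → α}

theorem exists_lab_of_ne (h8 : (verts K).card = 8) {v w : α} (hv : v ∈ verts K)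
    (hw : w ∈ verts K) (hvw : v ≠ w) : ∃ e, Lab K e ∧ e 7 = v ∧ e 6 = w := by
  set l := v :: w :: (((verts K).erase v).erase w).toList with hl
  have hw' : w ∈ (verts K).erase v := Finset.mem_erase.2 ⟨hvw.symm, hw⟩
  have hlen : l.length = 8 := by
    simp [hl, Finset.card_erase_of_mem hw', Finset.card_erase_of_mem hv, h8]
  have hnd : l.Nodup := by simp [hl, hvw, Finset.nodup_toList]
  have hmem : ∀ x, x ∈ l ↔ x ∈ verts K := by
    intro x
    by_cases h1 : x = v
    · simp [hl, h1, hv]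
    · by_cases h2 : x = w <;> simp [hl, h1, h2, hw]
  refine ⟨fun i => l.getD (7 - i) v, ⟨?_, ?_⟩, rfl, rfl⟩
  · intro i hi j hj hij
    have hi' : i < 8 := by simpa using hi
    have hj' : j < 8 := by simpa using hj
    have h1 : 7 - i < l.length := by omega
    have h2 : 7 - j < l.length := by omega
    simp only [List.getD_eq_getElem _ _ h1, List.getD_eq_getElem _ _ h2] at hij
    have := (List.Nodup.getElem_inj_iff hnd).1 hij
    omega
  · ext x
    rw [← hmem, Finset.mem_image, List.mem_iff_getElem]
    constructor
    · rintro ⟨i, hi, rfl⟩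
      have h1 : 7 - i < l.length := by omega
      exact ⟨7 - i, h1, by simp [h1]⟩
    · rintro ⟨i, hi, rfl⟩
      refine ⟨7 - i, by simp; omega, ?_⟩
      rw [show 7 - (7 - i) = i by omega, List.getD_eq_getElem _ _ hi]

theorem Lab.mem_verts (he : Lab K e) {i : ℕ} (hi : i < 8) : e i ∈ verts K := by
  rw [← he.img]
  exact Finset.mem_image_of_mem e (by simpa using hi)

theorem Lab.card_star_single (he : Lab K e) {i : ℕ} (hi : i < 8) :
    ((star (2 ^ i)).toFinset.filter fun n => pat K e n = true).card = facetDegree K {e i} := by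
  rw [he.card_star ((Nat.pow_lt_pow_right (by norm_num) hi).trans_eq (by norm_num : 2 ^ 8 = 256)),
    face, bits_two_pow hi, Finset.image_singleton, facetDegree]

theorem Lab.card_star_pair (he : Lab K e) {k : ℕ} (hk : k < 256) (hc : (bits k).card = 2) :
    ∃ v ∈ verts K, ∃ w ∈ verts K, v ≠ w ∧
      ((star k).toFinset.filter fun n => pat K e n = true).card = facetDegree K {v, w} := by
  have hf : (face e k).card = 2 := by rw [he.card_face, hc]
  obtain ⟨v, w, hvw, h⟩ := Finset.card_eq_two.1 hf
  have hs : face e k ⊆ verts K := by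
    rw [← he.img]
    exact Finset.image_subset_image (bits_subset_range k)
  rw [h, Finset.insert_subset_iff, Finset.singleton_subset_iff] at hs
  exact ⟨v, hs.1, w, hs.2, hvw, by rw [he.card_star hk, h, facetDegree]⟩

theorem Lab.card_star_edge (he : Lab K e) :
    ((star 192).toFinset.filter fun n => pat K e n = true).card = facetDegree K {e 7, e 6} := by
  rw [he.card_star (by norm_num), face, show bits 192 = {7, 6} by decide, Finset.image_insert,
    Finset.image_singleton, facetDegree]

/-- The condition of `exists_lab` on counts of facets at an edge. -/
theorem Lab.pair_forb (he : Lab K e) (hK : NormalPM K 3) (hN : Neighbourly K) {k : ℕ}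
    (hk : k < 256) (hc : (bits k).card = 2) :
    ((star k).toFinset.filter fun n => pat K e n = true).card ≠ 0 := by
  obtain ⟨v, hv, w, hw, hvw, h⟩ := he.card_star_pair hk hc
  rw [h]
  exact hN.facetDegree_ne_zero hK.1 hv hw hvw

theorem Lab.cone_forb (he : Lab K e) (hK : NormalPM K 3) (hN : Neighbourly K)
    {l : List (ℕ × ℕ)}
    (hl : ∀ p ∈ l, p.1 = 128 ∧ p.2 < 36 ∧ facetDegree K {e 7} ≠ p.2) :
    ∀ p ∈ cone ++ l, p.2 < 36 ∧
      ((star p.1).toFinset.filter fun n => pat K e n = true).card ≠ p.2 := by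
  intro p hp
  rcases List.mem_append.1 hp with hp | hp
  · have : ∀ p ∈ cone, p.1 < 256 ∧ (bits p.1).card = 2 ∧ p.2 = 0 := by decide
    obtain ⟨h1, h2, h3⟩ := this p hp
    rw [h3]
    exact ⟨by norm_num, he.pair_forb hK hN h1 h2⟩
  · obtain ⟨h1, h2, h3⟩ := hl p hp
    refine ⟨h2, ?_⟩
    rw [h1, show 128 = 2 ^ 7 by norm_num, he.card_star_single (by norm_num)]
    exact h3

/-- The search for the possible links of an edge. -/
theorem exists_lab_edge {forb : List (ℕ × ℕ)} {targets : List ℕ} {certs : List Cert}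
    (hs : searchOK 192 255 (star 192) 0 forb targets true certs = true) (hK : NormalPM K 3)
    (h8 : (verts K).card = 8) {v w : α} (hv : v ∈ verts K) (hw : w ∈ verts K) (hvw : v ≠ w)
    (hf : ∀ p ∈ forb, p.1 = 192 ∧ p.2 < 36 ∧ facetDegree K {v, w} ≠ p.2) :
    ∃ e, ∃ C ∈ targets, Lab K e ∧ e 7 = v ∧ ∀ n ∈ star 192, pat K e n = C.testBit n := by
  obtain ⟨e, he, rfl, rfl⟩ := exists_lab_of_ne h8 hv hw hvw
  obtain ⟨e', C, hC, he', h7, hp⟩ := exists_lab hs hK he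
    (fun n hn => absurd hn (by rw [show star 255 = [] by decide]; simp))
    fun p hp => by
      obtain ⟨h1, h2, h3⟩ := hf p hp
      refine ⟨h2, ?_⟩
      rw [h1, he.card_star_edge]
      exact h3
  exact ⟨e', C, hC, he', h7 rfl, hp⟩

theorem facetDegree_edge (hK : NormalPM K 3) (hN : Neighbourly K) (h8 : (verts K).card = 8)
    {v w : α} (hv : v ∈ verts K) (hw : w ∈ verts K) (hvw : v ≠ w) :
    facetDegree K {v, w} ∈ ({3, 4, 5, 6} : Finset ℕ) := by
  have h0 := hN.facetDegree_ne_zero hK.1 hv hw hvw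
  by_contra h
  simp only [Finset.mem_insert, Finset.mem_singleton, not_or] at h
  obtain ⟨e, C, hC, -⟩ := exists_lab_edge edge_search hK h8 hv hw hvw (by simp; tauto)
  simp at hC

theorem exists_facetDegree_eq_six (hK : NormalPM K 3) (hN : Neighbourly K)
    (h8 : (verts K).card = 8) {v : α} (hv : v ∈ verts K) (ht : facetDegree K {v} ≠ 10) :
    ∃ w ∈ verts K, v ≠ w ∧ facetDegree K {v, w} = 6 := by
  by_contra! h6
  have hsum := sum_facetDegree (K := K) (v := v)
  have hcard : ((verts K).erase v).card = 7 := by rw [Finset.card_erase_of_mem hv, h8]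
  have hd : ∀ w ∈ (verts K).erase v, 3 ≤ facetDegree K {v, w} ∧ facetDegree K {v, w} ≤ 5 := by
    intro w hw
    rw [Finset.mem_erase] at hw
    have h1 := facetDegree_edge hK hN h8 hv hw.2 hw.1.symm
    have h2 := h6 w hw.2 hw.1.symm
    simp only [Finset.mem_insert, Finset.mem_singleton] at h1
    omega
  have h5 := Finset.sum_le_card_nsmul _ _ _ fun w hw => (hd w hw).2
  have h3 := Finset.card_nsmul_le_sum _ _ _ fun w hw => (hd w hw).1
  rw [hsum, hcard, smul_eq_mul] at h5 h3
  obtain ⟨m, hm⟩ := hK.even_facetDegree hv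
  have ht8 : facetDegree K {v} = 8 := by omega
  obtain ⟨w, hw, hw3⟩ : ∃ w ∈ (verts K).erase v, facetDegree K {v, w} = 3 := by
    by_contra! hne
    have h4 := Finset.card_nsmul_le_sum _ (fun w => facetDegree K {v, w}) 4 fun w hw =>
      Nat.lt_of_le_of_ne (hd w hw).1 (hne w hw).symm
    rw [hsum, hcard, smul_eq_mul] at h4
    omega
  rw [Finset.mem_erase] at hw
  obtain ⟨e, C, hC, he, rfl, hp⟩ := exists_lab_edge triangle_search hK h8 hv hw.2 hw.1.symm
    (by simp [hw3])
  rw [List.mem_singleton.1 hC] at hp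
  obtain ⟨e', C', hC', -⟩ := exists_lab eight_search hK he hp
    (he.cone_forb hK hN (by simp [ht8]))
  simp at hC'

theorem exists_lab_hexagon (hK : NormalPM K 3) (hN : Neighbourly K) (h8 : (verts K).card = 8)
    {v : α} (hv : v ∈ verts K) (ht : facetDegree K {v} ≠ 10) :
    ∃ e, Lab K e ∧ e 7 = v ∧ ∀ n ∈ star 192, pat K e n = hexagon.testBit n := by
  obtain ⟨w, hw, hvw, h6⟩ := exists_facetDegree_eq_six hK hN h8 hv ht
  obtain ⟨e, C, hC, he, h7, hp⟩ := exists_lab_edge hexagon_search hK h8 hv hw hvw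
    (by simp [h6])
  rw [List.mem_singleton.1 hC] at hp
  exact ⟨e, he, h7, hp⟩

theorem Lab.facets_link (he : Lab K e) (hK : WeakPM K 3) {C : ℕ}
    (hC : ∀ n ∈ star 128, pat K e n = C.testBit n) :
    facets (link K {e 7}) 2 =
      (((star 128).filter (tb C)).toFinset.image fun n => n ^^^ 2 ^ 7).image (face e) := by
  have h7 : face e 128 = {e 7} := by
    rw [face, show bits 128 = {7} by decide, Finset.image_singleton]
  have hF := he.facets_eq_image (k := 128) (by norm_num)
  have hx : ∀ n ∈ star 128, face e (n ^^^ 2 ^ 7) = (face e n).erase (e 7) := by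
    intro n hn
    have hb : 7 ∈ bits n := bits_subset (mem_star.1 hn).2 (by decide)
    rw [face, bits_xor_two_pow hb, face]
    ext x
    simp only [Finset.mem_image, Finset.mem_erase]
    constructor
    · rintro ⟨i, ⟨hi, hin⟩, rfl⟩
      exact ⟨fun h => hi (he.injOn_bits n hin hb h), i, hin, rfl⟩
    · rintro ⟨hne, i, hin, rfl⟩
      exact ⟨i, ⟨fun h => hne (h ▸ rfl), hin⟩, rfl⟩
  rw [h7] at hF
  have hfil : ((star 128).filter (tb C)).toFinset =
      (star 128).toFinset.filter fun n => pat K e n = true := by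
    ext n
    simp only [List.mem_toFinset, List.mem_filter, Finset.mem_filter, tb_eq]
    exact and_congr_right fun hn => by rw [hC n hn]
  have himg : ((((star 128).filter (tb C)).toFinset.image fun n => n ^^^ 2 ^ 7).image (face e)) =
      (K.filter fun τ => {e 7} ⊆ τ ∧ τ.card = 4).image fun τ => τ.erase (e 7) := by
    rw [hfil, hF, Finset.image_image, Finset.image_image]
    refine Finset.image_congr fun n hn => hx n ?_
    simpa using (Finset.mem_filter.1 hn).1
  rw [himg]
  ext σ
  simp only [facets, Finset.mem_filter, Finset.mem_image, Finset.singleton_subset_iff]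
  constructor
  · rintro ⟨h, hc⟩
    obtain ⟨hv, hm⟩ := insert_mem_of_mem_link h
    exact ⟨_, ⟨hm, by simp, by rw [Finset.card_insert_of_notMem hv, hc]⟩,
      Finset.erase_insert hv⟩
  · rintro ⟨τ, ⟨hτ, hv, hc⟩, rfl⟩
    exact ⟨hK.1.erase_mem_link hτ hv (by omega), by rw [Finset.card_erase_of_mem hv, hc]⟩

theorem iso_T7 (hK : NormalPM K 3) (hN : Neighbourly K) (h8 : (verts K).card = 8)
    {v : α} (hv : v ∈ verts K) (ht : facetDegree K {v} = 14) : Iso (link K {v}) T7 := by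
  obtain ⟨e, he, rfl, hp⟩ := exists_lab_hexagon hK hN h8 hv (by omega)
  obtain ⟨e', C, hC, he', h7, hp'⟩ := exists_lab torus_search hK he hp
    (he.cone_forb hK hN (by simp [ht]))
  rw [List.mem_singleton.1 hC] at hp'
  have hW := hK.1.link (by omega) (hK.1.1.singleton_mem.2 hv)
  rw [T7_eq]
  refine iso_genCx hW.1 hW.2.1 he'.inj ?_
  rw [← h7 rfl]
  exact he'.facets_link hK.1 hp'

theorem iso_model (hK : WeakPM K 3) (he : Lab K e) {C : ℕ}
    (hC : ∀ n ∈ star 0, pat K e n = C.testBit n) : Iso K (model C) := by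
  refine iso_genCx hK.1 hK.2.1 he.inj ?_
  have hF := he.facets_eq_image (k := 0) (by norm_num)
  have h0 : face e 0 = ∅ := by rw [face, show bits 0 = ∅ by decide, Finset.image_empty]
  have hs : star 0 = tets := by decide
  rw [h0] at hF
  rw [hs] at hF hC
  have hfil : (tets.filter (tb C)).toFinset =
      tets.toFinset.filter fun n => pat K e n = true := by
    ext n
    simp only [List.mem_toFinset, List.mem_filter, Finset.mem_filter, tb_eq]
    exact and_congr_right fun hn => by rw [hC n hn]
  rw [hfil, ← hF]
  simp [facets]

theorem exists_lab_finals (hK : NormalPM K 3) (hN : Neighbourly K) (h8 : (verts K).card = 8)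
    {v : α} (hv : v ∈ verts K) (ht : facetDegree K {v} ≠ 10)
    (h14 : ∀ w ∈ verts K, facetDegree K {w} ≠ 14) :
    ∃ e, ∃ C ∈ finals, Lab K e ∧ ∀ n ∈ star 0, pat K e n = C.testBit n := by
  obtain ⟨e₀, he₀, rfl, hp₀⟩ := exists_lab_hexagon hK hN h8 hv ht
  obtain ⟨e, C, hC, he, -, hp⟩ := exists_lab plane_search hK he₀ hp₀
    (he₀.cone_forb hK hN (by simp [ht, h14 _ hv]))
  have hforb : ∀ p ∈ neighbourly, p.2 < 36 ∧
      ((star p.1).toFinset.filter fun n => pat K e n = true).card ≠ p.2 := by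
    intro p hp
    rcases List.mem_append.1 hp with hp | hp
    · obtain ⟨k, hk, rfl⟩ := List.mem_map.1 hp
      simp only [List.mem_filter, List.mem_range, beq_iff_eq] at hk
      exact ⟨by norm_num, he.pair_forb hK hN hk.1 hk.2⟩
    · obtain ⟨i, hi, rfl⟩ := List.mem_map.1 hp
      rw [List.mem_range] at hi
      refine ⟨by norm_num, ?_⟩
      rw [he.card_star_single hi]
      exact h14 _ (he.mem_verts hi)
  have main : ∀ {s : ℕ} {certs : List Cert},
      searchOK 0 128 order s neighbourly finals false certs = true → C = s →
      ∃ e, ∃ C ∈ finals, Lab K e ∧ ∀ n ∈ star 0, pat K e n = C.testBit n := by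
    rintro s certs h rfl
    obtain ⟨e', C', hC', he', -, hp'⟩ := exists_lab h hK he hp hforb
    exact ⟨e', C', hC', he', hp'⟩
  simp only [List.mem_cons, List.not_mem_nil, or_false] at hC
  rcases hC with h | h | h
  · exact main plane0_search h
  · exact main plane1_search h
  · exact main plane2_search h

end NPM.Search

/-- a neighbourly normal 3-pseudomanifold on 8 vertices which is
not a combinatorial 3-manifold and has no vertex with link isomorphic to the
7-vertex torus `T` is isomorphic to one of `N_5, N_6, …, N_15`. -/
theorem statement13 {α : Type u} [DecidableEq α] (K : NPM.Complex α)
    (h1 : NPM.NormalPM K 3) (h2 : NPM.Neighbourly K)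
    (h3 : (NPM.verts K).card = 8)
    (h4 : ¬ NPM.Comb3Mfd K)
    (h5 : ∀ v, ({v} : Finset α) ∈ K → ¬ NPM.Iso (NPM.link K {v}) T7) :
    ∃ X ∈ ([N5, N6, N7, N8, N9, N10, N11, N12, N13, N14, N15] :
      List (NPM.Complex ℕ)), NPM.Iso K X := by
  have hv : ∃ v ∈ NPM.verts K, NPM.facetDegree K {v} ≠ 10 := by
    by_contra! h
    exact h4 ⟨⟨h1.1, h1.sConn⟩, fun v hv =>
      h1.comb2Sphere_link h2 h3 hv (h v (h1.1.1.singleton_mem.1 hv))⟩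
  obtain ⟨v, hv, ht⟩ := hv
  obtain ⟨e, C, hC, he, hp⟩ := NPM.Search.exists_lab_finals h1 h2 h3 hv ht fun w hw h =>
    h5 w (h1.1.1.singleton_mem.2 hw) (NPM.Search.iso_T7 h1 h2 h3 hw h)
  refine ⟨NPM.Search.model C, ?_, NPM.Search.iso_model h1.1 he hp⟩
  rw [← NPM.Search.map_model_finals]
  exact List.mem_map_of_mem hC
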